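/- Let k be an algebraically closed field and let L_{n,d} denote the projective space of all nonzero homogeneous polynomials of degree d in k[x_0,…,x_n] up to scalar. Let W_n = {(P,L) ∈ P^n × Grass(1,n) : P ∈ L} and T_{n,d} = {((P,L),F) ∈ W_n × L_{n,d} : i(L, V_+(F); P) ≥ d}, where i(L, V_+(F); P) is the intersection multiplicity of the line L and the hypersurface V_+(F) at P (taken to be +∞ if L ⊆ V_+(F)). Then T_{n,d} is a closed subset of P^n × Grass(1,n) × L_{n,d}, it is an irreducible projective variety, and dim T_{n,d} = 2n−1 + dim(L_{n,d}) − d; moreover every fiber of the projection T_{n,d} → W_n is a projective linear subspace of L_{n,d} of dimension dim(L_{n,d}) − d. -/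

import Mathlib

/-!
STATEMENT 19: Let `k` be an algebraically closed field and let `L_{n,d}` denote the
projective space of all nonzero homogeneous polynomials of degree `d` in `k[x₀,…,xₙ]` up to
scalar.  Let `W_n = {(P,L) ∈ ℙⁿ × Grass(1,n) : P ∈ L}` and
`T_{n,d} = {((P,L),F) ∈ W_n × L_{n,d} : i(L, V₊(F); P) ≥ d}`.  Then `T_{n,d}` is a closed
subset of `ℙⁿ × Grass(1,n) × L_{n,d}`, it is an irreducible projective variety, and
`dim T_{n,d} = 2n−1 + dim L_{n,d} − d`; moreover every fiber of the projection
`T_{n,d} → W_n` is a projective linear subspace of `L_{n,d}` of dimension `dim L_{n,d} − d`.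

Encodings: `Grass(1,n)` is realised, via the Plücker embedding, as the locus of points of
`ℙ(Λ²k^{n+1})` represented by nonzero decomposable bivectors `v ∧ w`; `P ∈ L` means
`p ∧ (v ∧ w) = 0` for representatives; `i(L, V₊(F); P) ≥ d` means that for every
parametrisation `t ↦ p + t·u` of `L` with base point a representative `p` of `P`, the
univariate polynomial `F(p + t·u)` vanishes to order at least `d` at `t = 0`.  The ambient
product of the three projective spaces carries the Zariski topology, whose closed sets are
generated by zero sets of multihomogeneous polynomials in linear functionals of the three
underlying vector spaces; `dim` is the topological Krull dimension, and `dim L_{n,d} =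
C(n+d,d) − 1`.
-/

open MvPolynomial

noncomputable section

variable (k : Type) [Field k]

/-- multihomogeneity (of multidegree `(e₁,e₂,e₃)`) of a polynomial in three blocks of
variables -/
def IsTriHomogeneous {t₁ t₂ t₃ : ℕ} (F : MvPolynomial (Fin t₁ ⊕ Fin t₂ ⊕ Fin t₃) k)
    (e₁ e₂ e₃ : ℕ) : Prop :=
  ∀ m ∈ F.support, (∑ i : Fin t₁, m (Sum.inl i)) = e₁ ∧
    (∑ i : Fin t₂, m (Sum.inr (Sum.inl i))) = e₂ ∧
    (∑ i : Fin t₃, m (Sum.inr (Sum.inr i))) = e₃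

variable (M₁ M₂ M₃ : Type) [AddCommGroup M₁] [Module k M₁] [AddCommGroup M₂] [Module k M₂]
  [AddCommGroup M₃] [Module k M₃]

/-- The Zariski topology on a product of three projectivizations: the open sets are
generated by the complements of zero sets of multihomogeneous polynomials in linear
functionals of the three underlying vector spaces. -/
def zariskiTopology3 :
    TopologicalSpace (Projectivization k M₁ × Projectivization k M₂ × Projectivization k M₃) :=
  TopologicalSpace.generateFrom
    {U | ∃ (t₁ t₂ t₃ : ℕ) (F : MvPolynomial (Fin t₁ ⊕ Fin t₂ ⊕ Fin t₃) k)
        (e₁ e₂ e₃ : ℕ) (_ : IsTriHomogeneous k F e₁ e₂ e₃)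
        (l₁ : Fin t₁ → (M₁ →ₗ[k] k)) (l₂ : Fin t₂ → (M₂ →ₗ[k] k))
        (l₃ : Fin t₃ → (M₃ →ₗ[k] k)),
      U = {z | ∀ (v₁ : M₁) (h₁ : v₁ ≠ 0) (v₂ : M₂) (h₂ : v₂ ≠ 0) (v₃ : M₃) (h₃ : v₃ ≠ 0),
        Projectivization.mk k v₁ h₁ = z.1 → Projectivization.mk k v₂ h₂ = z.2.1 →
        Projectivization.mk k v₃ h₃ = z.2.2 →
        MvPolynomial.eval
          (Sum.elim (fun i => l₁ i v₁)
            (Sum.elim (fun i => l₂ i v₂) (fun i => l₃ i v₃))) F ≠ 0}}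

variable (n d : ℕ)

/-- the wedge `v ∧ w`, as an element of the exterior square -/
def wedge (v w : Fin (n+1) → k) : ⋀[k]^2 (Fin (n+1) → k) :=
  ⟨ExteriorAlgebra.ι k v * ExteriorAlgebra.ι k w, by
    show _ ∈ LinearMap.range (ExteriorAlgebra.ι k (M := Fin (n+1) → k)) ^ 2
    rw [sq]
    exact Submodule.mul_mem_mul (LinearMap.mem_range_self _ v)
      (LinearMap.mem_range_self _ w)⟩

/-- the ambient space `ℙⁿ × ℙ(Λ²k^{n+1}) × L_{n,d}` -/
abbrev AmbientSpace :=
  Projectivization k (Fin (n+1) → k) ×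
    Projectivization k (⋀[k]^2 (Fin (n+1) → k)) ×
    Projectivization k (homogeneousSubmodule (Fin (n+1)) k d)

/-- `L` lies in `Grass(1,n)` (Plücker): it is represented by a nonzero decomposable
bivector. -/
def IsLine (L : Projectivization k (⋀[k]^2 (Fin (n+1) → k))) : Prop :=
  ∃ (v w : Fin (n+1) → k) (h : wedge k n v w ≠ 0), Projectivization.mk k (wedge k n v w) h = L

/-- the incidence condition `P ∈ L` -/
def Incident (P : Projectivization k (Fin (n+1) → k))
    (L : Projectivization k (⋀[k]^2 (Fin (n+1) → k))) : Prop :=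
  ∀ (p : Fin (n+1) → k) (hp : p ≠ 0)
    (ω : ⋀[k]^2 (Fin (n+1) → k)) (hω : ω ≠ 0),
    Projectivization.mk k p hp = P → Projectivization.mk k ω hω = L →
    ExteriorAlgebra.ι k p * (ω : ExteriorAlgebra k (Fin (n+1) → k)) = 0

/-- the condition `i(L, V₊(F); P) ≥ d`: along every parametrisation `t ↦ p + t u` of `L`
based at a representative `p` of `P`, the polynomial `F(p + tu) ∈ k[t]` vanishes to order
at least `d` at `t = 0` (in particular identically if `L ⊆ V₊(F)`). -/
def MultCond (P : Projectivization k (Fin (n+1) → k))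
    (L : Projectivization k (⋀[k]^2 (Fin (n+1) → k)))
    (F : Projectivization k (homogeneousSubmodule (Fin (n+1)) k d)) : Prop :=
  ∀ (p : Fin (n+1) → k) (hp : p ≠ 0), Projectivization.mk k p hp = P →
    ∀ (u : Fin (n+1) → k) (h : wedge k n p u ≠ 0),
      Projectivization.mk k (wedge k n p u) h = L →
      ∀ (f : homogeneousSubmodule (Fin (n+1)) k d) (hf : f ≠ 0),
        Projectivization.mk k f hf = F →
        ∀ j : ℕ, j < d →
          Polynomial.coeff
            (MvPolynomial.aeval
              (fun i : Fin (n+1) =>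
                (Polynomial.C (p i) + Polynomial.X * Polynomial.C (u i) : Polynomial k))
              (f : MvPolynomial (Fin (n+1)) k)) j = 0

/-- the incidence variety `T_{n,d} ⊆ ℙⁿ × Grass(1,n) × L_{n,d}` -/
def Tnd : Set (AmbientSpace k n d) :=
  {z | IsLine k n z.2.1 ∧ Incident k n z.1 z.2.1 ∧ MultCond k n d z.1 z.2.1 z.2.2}

attribute [local instance] zariskiTopology3

section Auxiliary

variable {k n d}

section AffineSpace

/-- The Zariski topology on the `k`-points of affine space with coordinates indexed by `σ`. -/
abbrev affineZariskiTopology (k σ : Type) [Field k] : TopologicalSpace (σ → k) :=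
  TopologicalSpace.induced (fun x : σ → k => (pointToPoint x : PrimeSpectrum (MvPolynomial σ k)))
    inferInstance

attribute [local instance] affineZariskiTopology

namespace AffineZariski

variable {σ τ : Type}

lemma isInducing_pointToPoint :
    Topology.IsInducing
      (fun x : σ → k => (pointToPoint (K := k) x : PrimeSpectrum (MvPolynomial σ k))) :=
  ⟨rfl⟩

lemma preimage_basicOpen (g : MvPolynomial σ k) :
    (fun x : σ → k => (pointToPoint (K := k) x : PrimeSpectrum (MvPolynomial σ k))) ⁻¹'
      (PrimeSpectrum.basicOpen g : Set (PrimeSpectrum (MvPolynomial σ k))) =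
      {x | eval x g ≠ 0} := by
  ext x
  simp [pointToPoint, mem_vanishingIdeal_iff, aeval_eq_eval]

lemma isTopologicalBasis :
    TopologicalSpace.IsTopologicalBasis
      {U : Set (σ → k) | ∃ g : MvPolynomial σ k, U = {x | eval x g ≠ 0}} := by
  have h := (PrimeSpectrum.isTopologicalBasis_basic_opens (R := MvPolynomial σ k)).isInducing
    (isInducing_pointToPoint (k := k) (σ := σ))
  convert h using 1
  ext U
  constructor
  · rintro ⟨g, rfl⟩
    exact ⟨_, ⟨g, rfl⟩, preimage_basicOpen g⟩
  · rintro ⟨_, ⟨g, rfl⟩, rfl⟩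
    exact ⟨g, preimage_basicOpen g⟩

lemma isOpen_eval_ne_zero (g : MvPolynomial σ k) : IsOpen {x : σ → k | eval x g ≠ 0} :=
  isTopologicalBasis.isOpen ⟨g, rfl⟩

lemma continuous_of_polynomial (F : τ → MvPolynomial σ k) :
    Continuous (fun (x : σ → k) => (fun t => eval x (F t) : τ → k)) := by
  refine isTopologicalBasis.continuous_iff.mpr ?_
  rintro _ ⟨g, rfl⟩
  convert isOpen_eval_ne_zero (bind₁ F g) using 1
  ext x
  simp only [Set.mem_preimage, Set.mem_ofPred_eq, eval, eval₂Hom_bind₁]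

lemma irreducibleSpace [Infinite k] : IrreducibleSpace (σ → k) where
  isPreirreducible_univ := by
    rintro U V hU hV ⟨x, -, hx⟩ ⟨y, -, hy⟩
    obtain ⟨_, ⟨g, rfl⟩, hgx, hgU⟩ := isTopologicalBasis.exists_subset_of_mem_open hx hU
    obtain ⟨_, ⟨h, rfl⟩, hhy, hhV⟩ := isTopologicalBasis.exists_subset_of_mem_open hy hV
    have hg : g ≠ 0 := by rintro rfl; exact hgx (map_zero _)
    have hh : h ≠ 0 := by rintro rfl; exact hhy (map_zero _)
    by_contra hne
    apply mul_ne_zero hg hh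
    apply MvPolynomial.funext
    intro z
    by_contra hz
    rw [map_zero, map_mul, mul_eq_zero, not_or] at hz
    exact hne ⟨z, trivial, hgU hz.1, hhV hz.2⟩
  toNonempty := ⟨fun _ => (0 : k)⟩

lemma topologicalKrullDim_le [Finite σ] :
    topologicalKrullDim (σ → k) ≤ Nat.card σ := by
  refine (isInducing_pointToPoint (k := k) (σ := σ)).topologicalKrullDim_le.trans ?_
  rw [PrimeSpectrum.topologicalKrullDim_eq_ringKrullDim, ringKrullDim_of_isNoetherianRing]
  simp

lemma le_topologicalKrullDim_fin [Infinite k] (N : ℕ) :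
    (N : WithBot ℕ∞) ≤ topologicalKrullDim (Fin N → k) := by
  have hset : ∀ j : ℕ, {x : Fin N → k | ∀ i : Fin N, j ≤ i → x i = 0} =
      Set.range (fun (x : Fin N → k) =>
        (fun t => eval x (if (t : ℕ) < j then X t else 0) : Fin N → k)) := by
    intro j
    ext x
    constructor
    · intro hx
      refine ⟨x, ?_⟩
      funext t
      by_cases h : (t : ℕ) < j
      · simp [h]
      · simp [h, hx t (not_lt.mp h)]
    · rintro ⟨y, rfl⟩ i hi
      simp [not_lt.mpr hi]
  let Z : Fin (N + 1) → TopologicalSpace.IrreducibleCloseds (Fin N → k) := fun j =>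
    { carrier := {x | ∀ i : Fin N, (j : ℕ) ≤ i → x i = 0}
      isIrreducible' := by
        rw [hset, ← Set.image_univ]
        have := irreducibleSpace (k := k) (σ := Fin N)
        exact (IrreducibleSpace.isIrreducible_univ _).image _
          (continuous_of_polynomial _).continuousOn
      isClosed' := by
        simp only [Set.ofPred_forall]
        refine isClosed_iInter fun i => isClosed_iInter fun _ => ?_
        rw [← isOpen_compl_iff]
        convert isOpen_eval_ne_zero (X i : MvPolynomial (Fin N) k) using 1
        ext x
        simp }
  have hZ : StrictMono Z := by
    intro a b hab
    refine lt_of_le_not_ge (fun x hx i hi => hx i (le_trans (Fin.lt_def.mp hab).le hi)) fun h => ?_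
    have ha : (a : ℕ) < N := lt_of_lt_of_le hab (Nat.lt_succ_iff.mp b.2)
    have hmem : (fun i => if i = ⟨a, ha⟩ then 1 else 0 : Fin N → k) ∈ Z b := by
      intro i hi
      have : i ≠ ⟨a, ha⟩ := by
        rintro rfl
        exact absurd hab (not_lt.mpr hi)
      simp [this]
    have := h hmem ⟨a, ha⟩ le_rfl
    simp at this
  exact Order.LTSeries.length_le_krullDim (LTSeries.mk N Z hZ)

lemma topologicalKrullDim_eq [Infinite k] [Finite σ] :
    topologicalKrullDim (σ → k) = Nat.card σ := by
  refine le_antisymm topologicalKrullDim_le ((le_topologicalKrullDim_fin (k := k) _).trans ?_)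
  let e := Finite.equivFin σ
  refine Topology.IsInducing.topologicalKrullDim_le (f := fun (x : Fin (Nat.card σ) → k) =>
    (fun t => eval x (X (e t)) : σ → k)) ?_
  refine Topology.IsInducing.of_comp (continuous_of_polynomial _)
    (continuous_of_polynomial fun t => X (e.symm t)) ?_
  convert Topology.IsInducing.id
  ext x
  simp

lemma t0Space : T0Space (σ → k) := by
  refine ⟨fun x y hxy => funext fun s => ?_⟩
  have := hxy.mem_open_iff (isOpen_eval_ne_zero (X s - C (y s)))
  simpa [sub_eq_zero] using this

end AffineZariski

/-- A space covered by open images of spaces of dimension at most `N` has dimension at most `N`. -/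
lemma topologicalKrullDim_le_of_forall_isOpenEmbedding {Y : Type*} [TopologicalSpace Y]
    (N : WithBot ℕ∞)
    (h : ∀ y : Y, ∃ (X : Type) (_ : TopologicalSpace X) (φ : X → Y),
      Topology.IsOpenEmbedding φ ∧ y ∈ Set.range φ ∧ topologicalKrullDim X ≤ N) :
    topologicalKrullDim Y ≤ N := by
  refine iSup_le fun s => ?_
  obtain ⟨y, hy⟩ := (s 0).isIrreducible.nonempty
  obtain ⟨X, _, φ, hφ, ⟨x, rfl⟩, hX⟩ := h y
  refine le_trans ?_ hX
  let Z : Fin (s.length + 1) → TopologicalSpace.IrreducibleCloseds X := fun j =>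
    { carrier := φ ⁻¹' (s j : Set Y)
      isIrreducible' := by
        refine ⟨⟨x, s.monotone (Fin.zero_le j) hy⟩, ?_⟩
        exact (s j).isIrreducible.isPreirreducible.preimage hφ
      isClosed' := (s j).isClosed.preimage hφ.continuous }
  have hmono : StrictMono Z := by
    intro a b hab
    refine lt_of_le_not_ge (fun z hz => s.monotone hab.le hz) fun hle => ?_
    have hlt := s.strictMono hab
    apply absurd hlt (not_lt_of_ge ?_)
    have hcl : (s b : Set Y) ⊆ closure ((s b : Set Y) ∩ Set.range φ) :=
      subset_closure_inter_of_isPreirreducible_of_isOpen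
        (s b).isIrreducible.isPreirreducible hφ.isOpen_range
        ⟨φ x, s.monotone (Fin.zero_le b) hy, ⟨x, rfl⟩⟩
    intro z hz
    refine (closure_minimal ?_ (s a).isClosed) (hcl hz)
    rintro _ ⟨hw, w, rfl⟩
    exact hle hw
  exact Order.LTSeries.length_le_krullDim (LTSeries.mk s.length Z hmono)

end AffineSpace

section TriForm

/-- The weights defining the tridegree of a monomial in three blocks of variables. -/
def triWeight (ι₁ ι₂ ι₃ : Type) : ι₁ ⊕ ι₂ ⊕ ι₃ → ℕ × ℕ × ℕ :=
  Sum.elim (fun _ => (1, 0, 0)) (Sum.elim (fun _ => (0, 1, 0)) (fun _ => (0, 0, 1)))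

lemma weight_triWeight {t₁ t₂ t₃ : ℕ} (m : Fin t₁ ⊕ Fin t₂ ⊕ Fin t₃ →₀ ℕ) :
    Finsupp.weight (triWeight (Fin t₁) (Fin t₂) (Fin t₃)) m =
      (∑ i : Fin t₁, m (Sum.inl i), ∑ i : Fin t₂, m (Sum.inr (Sum.inl i)),
        ∑ i : Fin t₃, m (Sum.inr (Sum.inr i))) := by
  rw [Finsupp.weight_apply, Finsupp.sum_fintype _ _ (by simp)]
  simp [triWeight, Fintype.sum_sum_type, Prod.ext_iff, Prod.fst_sum, Prod.snd_sum]

lemma isTriHomogeneous_iff {t₁ t₂ t₃ : ℕ} (F : MvPolynomial (Fin t₁ ⊕ Fin t₂ ⊕ Fin t₃) k)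
    (e₁ e₂ e₃ : ℕ) :
    IsTriHomogeneous k F e₁ e₂ e₃ ↔
      IsWeightedHomogeneous (triWeight (Fin t₁) (Fin t₂) (Fin t₃)) F (e₁, e₂, e₃) := by
  simp [IsTriHomogeneous, IsWeightedHomogeneous, weight_triWeight]

variable {M₁ M₂ M₃} [FiniteDimensional k M₁] [FiniteDimensional k M₂]
  [FiniteDimensional k M₃]

/-- The coordinate functions, with respect to chosen bases, on a product of three
finite-dimensional spaces. -/
def triCoord (k M₁ M₂ M₃ : Type) [Field k] [AddCommGroup M₁] [Module k M₁] [AddCommGroup M₂]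
    [Module k M₂] [AddCommGroup M₃] [Module k M₃] [FiniteDimensional k M₁]
    [FiniteDimensional k M₂] [FiniteDimensional k M₃] :
    Fin (Module.finrank k M₁) ⊕ Fin (Module.finrank k M₂) ⊕ Fin (Module.finrank k M₃) →
      (M₁ × M₂ × M₃ → k) :=
  Sum.elim (fun i v => (Module.finBasis k M₁).coord i v.1)
    (Sum.elim (fun i v => (Module.finBasis k M₂).coord i v.2.1)
      (fun i v => (Module.finBasis k M₃).coord i v.2.2))

/-- The functions on `M₁ × M₂ × M₃` given by polynomials homogeneous of the given tridegree. -/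
def triForm (k M₁ M₂ M₃ : Type) [Field k] [AddCommGroup M₁] [Module k M₁] [AddCommGroup M₂]
    [Module k M₂] [AddCommGroup M₃] [Module k M₃] [FiniteDimensional k M₁]
    [FiniteDimensional k M₂] [FiniteDimensional k M₃] (e : ℕ × ℕ × ℕ) :
    Submodule k (M₁ × M₂ × M₃ → k) :=
  (weightedHomogeneousSubmodule k (triWeight _ _ _) e).map
    (aeval (triCoord k M₁ M₂ M₃)).toLinearMap

instance triForm.gradedMonoid : SetLike.GradedMonoid (triForm k M₁ M₂ M₃) where
  one_mem := ⟨1, isWeightedHomogeneous_one _ _, by simp⟩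
  mul_mem := by
    rintro a b _ _ ⟨F, hF, rfl⟩ ⟨G, hG, rfl⟩
    exact ⟨F * G, IsWeightedHomogeneous.mul hF hG, by simp⟩

lemma triForm.triCoord_mem (i) :
    triCoord k M₁ M₂ M₃ i ∈ triForm k M₁ M₂ M₃ (triWeight _ _ _ i) :=
  ⟨X i, isWeightedHomogeneous_X k _ _, by simp⟩

lemma triForm.fst_mem (l : M₁ →ₗ[k] k) : (fun v => l v.1) ∈ triForm k M₁ M₂ M₃ (1, 0, 0) := by
  have : (fun v : M₁ × M₂ × M₃ => l v.1) = ∑ i, l (Module.finBasis k M₁ i) •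
      triCoord k M₁ M₂ M₃ (Sum.inl i) := by
    ext v
    conv_lhs => rw [← (Module.finBasis k M₁).sum_repr v.1, map_sum]
    simp only [map_smul, smul_eq_mul, Finset.sum_apply, Pi.smul_apply, triCoord, Sum.elim_inl,
      Module.Basis.coord_apply, mul_comm]
  rw [this]
  exact Submodule.sum_mem _ fun i _ => Submodule.smul_mem _ _ (triForm.triCoord_mem (Sum.inl i))

lemma triForm.snd_mem (l : M₂ →ₗ[k] k) : (fun v => l v.2.1) ∈ triForm k M₁ M₂ M₃ (0, 1, 0) := by
  have : (fun v : M₁ × M₂ × M₃ => l v.2.1) = ∑ i, l (Module.finBasis k M₂ i) •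
      triCoord k M₁ M₂ M₃ (Sum.inr (Sum.inl i)) := by
    ext v
    conv_lhs => rw [← (Module.finBasis k M₂).sum_repr v.2.1, map_sum]
    simp only [map_smul, smul_eq_mul, Finset.sum_apply, Pi.smul_apply, triCoord, Sum.elim_inl,
      Sum.elim_inr, Module.Basis.coord_apply, mul_comm]
  rw [this]
  exact Submodule.sum_mem _ fun i _ => Submodule.smul_mem _ _
    (triForm.triCoord_mem (Sum.inr (Sum.inl i)))

lemma triForm.thd_mem (l : M₃ →ₗ[k] k) : (fun v => l v.2.2) ∈ triForm k M₁ M₂ M₃ (0, 0, 1) := by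
  have : (fun v : M₁ × M₂ × M₃ => l v.2.2) = ∑ i, l (Module.finBasis k M₃ i) •
      triCoord k M₁ M₂ M₃ (Sum.inr (Sum.inr i)) := by
    ext v
    conv_lhs => rw [← (Module.finBasis k M₃).sum_repr v.2.2, map_sum]
    simp only [map_smul, smul_eq_mul, Finset.sum_apply, Pi.smul_apply, triCoord, Sum.elim_inr,
      Module.Basis.coord_apply, mul_comm]
  rw [this]
  exact Submodule.sum_mem _ fun i _ => Submodule.smul_mem _ _
    (triForm.triCoord_mem (Sum.inr (Sum.inr i)))

/-- Substituting functions of degree `w i` for variables of weight `w i`. -/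
lemma triForm.aeval_mem {ι : Type} {w : ι → ℕ × ℕ × ℕ} {F : MvPolynomial ι k} {e : ℕ × ℕ × ℕ}
    (hF : IsWeightedHomogeneous w F e) (c : ι → M₁ × M₂ × M₃ → k)
    (hc : ∀ i, c i ∈ triForm k M₁ M₂ M₃ (w i)) : aeval c F ∈ triForm k M₁ M₂ M₃ e := by
  rw [aeval_def, eval₂_eq]
  refine Submodule.sum_mem _ fun m hm => ?_
  rw [← Algebra.smul_def]
  refine Submodule.smul_mem _ _ ?_
  rw [← hF (mem_support_iff.mp hm), Finsupp.weight_apply]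
  exact SetLike.prod_pow_mem_graded _ _ _ _ fun i _ => hc i

lemma triForm.smul_apply {e : ℕ × ℕ × ℕ} {h : M₁ × M₂ × M₃ → k} (hh : h ∈ triForm k M₁ M₂ M₃ e)
    (s : k × k × k) (v : M₁ × M₂ × M₃) :
    h (s.1 • v.1, s.2.1 • v.2.1, s.2.2 • v.2.2) =
      s.1 ^ e.1 * s.2.1 ^ e.2.1 * s.2.2 ^ e.2.2 * h v := by
  obtain ⟨F, hF, rfl⟩ := hh
  simp only [AlgHom.toLinearMap_apply, aeval_def, eval₂_eq, Finset.sum_apply, Pi.mul_apply,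
    Finset.prod_apply, Pi.pow_apply, Finset.mul_sum]
  refine Finset.sum_congr rfl fun m hm => ?_
  have hw := hF (mem_support_iff.mp hm)
  rw [weight_triWeight] at hw
  subst hw
  rw [Finset.prod_subset (Finset.subset_univ m.support) (by simp +contextual),
    Finset.prod_subset (Finset.subset_univ m.support) (by simp +contextual)]
  simp only [Fintype.prod_sum_type, triCoord, Sum.elim_inl, Sum.elim_inr, map_smul, smul_eq_mul,
    mul_pow, Finset.prod_mul_distrib, Finset.prod_pow_eq_pow_sum]
  simp
  ring

/-- The non-vanishing locus of a function on a product of three projective spaces. -/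
def triNonvanishing (h : M₁ × M₂ × M₃ → k) :
    Set (Projectivization k M₁ × Projectivization k M₂ × Projectivization k M₃) :=
  {z | h (z.1.rep, z.2.1.rep, z.2.2.rep) ≠ 0}

lemma mk_mem_triNonvanishing {e : ℕ × ℕ × ℕ} {h : M₁ × M₂ × M₃ → k}
    (hh : h ∈ triForm k M₁ M₂ M₃ e) {v₁ : M₁} {v₂ : M₂} {v₃ : M₃} (h₁ : v₁ ≠ 0) (h₂ : v₂ ≠ 0)
    (h₃ : v₃ ≠ 0) :
    (Projectivization.mk k v₁ h₁, Projectivization.mk k v₂ h₂, Projectivization.mk k v₃ h₃) ∈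
      triNonvanishing h ↔ h (v₁, v₂, v₃) ≠ 0 := by
  obtain ⟨a, ha⟩ := Projectivization.exists_smul_eq_mk_rep k v₁ h₁
  obtain ⟨b, hb⟩ := Projectivization.exists_smul_eq_mk_rep k v₂ h₂
  obtain ⟨c, hc⟩ := Projectivization.exists_smul_eq_mk_rep k v₃ h₃
  have := triForm.smul_apply hh (a, b, c) (v₁, v₂, v₃)
  simp only [triNonvanishing, Set.mem_ofPred_eq, ← ha, ← hb, ← hc]
  simp only [Units.smul_def, this]
  simp

lemma setOf_forall_eq_triNonvanishing {e : ℕ × ℕ × ℕ} {h : M₁ × M₂ × M₃ → k}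
    (hh : h ∈ triForm k M₁ M₂ M₃ e) :
    {z | ∀ (v₁ : M₁) (h₁ : v₁ ≠ 0) (v₂ : M₂) (h₂ : v₂ ≠ 0) (v₃ : M₃) (h₃ : v₃ ≠ 0),
        Projectivization.mk k v₁ h₁ = z.1 → Projectivization.mk k v₂ h₂ = z.2.1 →
        Projectivization.mk k v₃ h₃ = z.2.2 → h (v₁, v₂, v₃) ≠ 0} = triNonvanishing h := by
  ext ⟨z₁, z₂, z₃⟩
  constructor
  · intro H
    exact H _ z₁.rep_nonzero _ z₂.rep_nonzero _ z₃.rep_nonzero z₁.mk_rep z₂.mk_rep z₃.mk_rep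
  · rintro H v₁ h₁ v₂ h₂ v₃ h₃ rfl rfl rfl
    exact (mk_mem_triNonvanishing hh h₁ h₂ h₃).mp H

lemma isOpen_triNonvanishing {e : ℕ × ℕ × ℕ} {h : M₁ × M₂ × M₃ → k}
    (hh : h ∈ triForm k M₁ M₂ M₃ e) : IsOpen (triNonvanishing (k := k) h) := by
  rw [← setOf_forall_eq_triNonvanishing hh]
  obtain ⟨F, hF, rfl⟩ := hh
  apply TopologicalSpace.isOpen_generateFrom_of_mem
  refine ⟨_, _, _, F, e.1, e.2.1, e.2.2, (isTriHomogeneous_iff F _ _ _).mpr hF,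
    (Module.finBasis k M₁).coord, (Module.finBasis k M₂).coord, (Module.finBasis k M₃).coord, ?_⟩
  have key : ∀ (v₁ : M₁) (v₂ : M₂) (v₃ : M₃),
      (aeval (triCoord k M₁ M₂ M₃)).toLinearMap F (v₁, v₂, v₃) =
      eval (Sum.elim (fun i => (Module.finBasis k M₁).coord i v₁)
        (Sum.elim (fun i => (Module.finBasis k M₂).coord i v₂)
          (fun i => (Module.finBasis k M₃).coord i v₃))) F := by
    intro v₁ v₂ v₃
    simp only [AlgHom.toLinearMap_apply, aeval_def, eval₂_eq, eval_eq, Finset.sum_apply,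
      Pi.mul_apply, Finset.prod_apply, Pi.pow_apply, Pi.algebraMap_apply, Algebra.algebraMap_self,
      RingHom.id_apply]
    refine Finset.sum_congr rfl fun m _ => ?_
    congr 1
    refine Finset.prod_congr rfl fun i _ => ?_
    rcases i with i | i | i <;> rfl
  simp only [key]

/-- The map into a product of projective spaces given by polynomial representatives is
continuous. -/
lemma continuous_mk_of_polynomial {X : Type*} [TopologicalSpace X]
    (p : X → M₁) (q : X → M₂) (r : X → M₃) (hp : ∀ x, p x ≠ 0) (hq : ∀ x, q x ≠ 0)
    (hr : ∀ x, r x ≠ 0)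
    (H : ∀ (e : ℕ × ℕ × ℕ), ∀ h ∈ triForm k M₁ M₂ M₃ e, IsOpen {x | h (p x, q x, r x) ≠ 0}) :
    Continuous fun x => (Projectivization.mk k (p x) (hp x), Projectivization.mk k (q x) (hq x),
      Projectivization.mk k (r x) (hr x)) := by
  refine continuous_generateFrom_iff.mpr ?_
  rintro _ ⟨t₁, t₂, t₃, F, e₁, e₂, e₃, hF, l₁, l₂, l₃, rfl⟩
  rw [isTriHomogeneous_iff] at hF
  let c : Fin t₁ ⊕ Fin t₂ ⊕ Fin t₃ → M₁ × M₂ × M₃ → k :=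
    Sum.elim (fun i v => l₁ i v.1) (Sum.elim (fun i v => l₂ i v.2.1) (fun i v => l₃ i v.2.2))
  have hc : aeval c F ∈ triForm k M₁ M₂ M₃ (e₁, e₂, e₃) := by
    refine triForm.aeval_mem hF c ?_
    rintro (i | i | i)
    · exact triForm.fst_mem _
    · exact triForm.snd_mem _
    · exact triForm.thd_mem _
  have key : ∀ (v₁ : M₁) (v₂ : M₂) (v₃ : M₃),
      eval (Sum.elim (fun i => l₁ i v₁) (Sum.elim (fun i => l₂ i v₂) (fun i => l₃ i v₃))) F =
      aeval c F (v₁, v₂, v₃) := by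
    intro v₁ v₂ v₃
    simp only [aeval_def, eval₂_eq, eval_eq, Finset.sum_apply,
      Pi.mul_apply, Finset.prod_apply, Pi.pow_apply, Pi.algebraMap_apply, Algebra.algebraMap_self,
      RingHom.id_apply]
    refine Finset.sum_congr rfl fun m _ => ?_
    congr 1
    refine Finset.prod_congr rfl fun i _ => ?_
    rcases i with i | i | i <;> rfl
  simp only [key]
  rw [setOf_forall_eq_triNonvanishing hc]
  convert H _ _ hc using 1
  ext x
  exact mk_mem_triNonvanishing hc _ _ _

attribute [local instance] affineZariskiTopology

lemma triForm.exists_eval_eq {σ : Type} {p : (σ → k) → M₁} {q : (σ → k) → M₂} {r : (σ → k) → M₃}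
    (hp : ∀ l : M₁ →ₗ[k] k, ∃ g : MvPolynomial σ k, ∀ x, l (p x) = eval x g)
    (hq : ∀ l : M₂ →ₗ[k] k, ∃ g : MvPolynomial σ k, ∀ x, l (q x) = eval x g)
    (hr : ∀ l : M₃ →ₗ[k] k, ∃ g : MvPolynomial σ k, ∀ x, l (r x) = eval x g)
    {e : ℕ × ℕ × ℕ} {h : M₁ × M₂ × M₃ → k} (hh : h ∈ triForm k M₁ M₂ M₃ e) :
    ∃ g : MvPolynomial σ k, ∀ x, h (p x, q x, r x) = eval x g := by
  obtain ⟨F, -, rfl⟩ := hh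
  have hc : ∀ i, ∃ g : MvPolynomial σ k, ∀ x, triCoord k M₁ M₂ M₃ i (p x, q x, r x) = eval x g := by
    rintro (i | i | i)
    · exact hp _
    · exact hq _
    · exact hr _
  choose g hg using hc
  refine ⟨bind₁ g F, fun x => ?_⟩
  simp only [eval, eval₂Hom_bind₁]
  simp only [AlgHom.toLinearMap_apply, aeval_def, coe_eval₂Hom, eval₂_eq, Finset.sum_apply,
    Pi.mul_apply, Finset.prod_apply, Pi.pow_apply, Pi.algebraMap_apply, Algebra.algebraMap_self,
    hg, eval]

/-- A map from affine space to a product of projective spaces, given by polynomial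
representatives, is inducing if all affine coordinates are quotients of forms of equal degree with
non-vanishing denominators. -/
lemma isInducing_mk_of_polynomial {σ : Type} [Finite σ]
    {p : (σ → k) → M₁} {q : (σ → k) → M₂} {r : (σ → k) → M₃} (hp0 : ∀ x, p x ≠ 0)
    (hq0 : ∀ x, q x ≠ 0) (hr0 : ∀ x, r x ≠ 0)
    (hp : ∀ l : M₁ →ₗ[k] k, ∃ g : MvPolynomial σ k, ∀ x, l (p x) = eval x g)
    (hq : ∀ l : M₂ →ₗ[k] k, ∃ g : MvPolynomial σ k, ∀ x, l (q x) = eval x g)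
    (hr : ∀ l : M₃ →ₗ[k] k, ∃ g : MvPolynomial σ k, ∀ x, l (r x) = eval x g)
    (e : σ → ℕ × ℕ × ℕ) (num den : σ → M₁ × M₂ × M₃ → k)
    (hnum : ∀ s, num s ∈ triForm k M₁ M₂ M₃ (e s)) (hden : ∀ s, den s ∈ triForm k M₁ M₂ M₃ (e s))
    (hnum_eq : ∀ s x, num s (p x, q x, r x) = x s) (hden_eq : ∀ s x, den s (p x, q x, r x) = 1) :
    Topology.IsInducing fun x => (Projectivization.mk k (p x) (hp0 x),
      Projectivization.mk k (q x) (hq0 x), Projectivization.mk k (r x) (hr0 x)) := by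
  have := Fintype.ofFinite σ
  have hcont : Continuous fun x => (Projectivization.mk k (p x) (hp0 x),
      Projectivization.mk k (q x) (hq0 x), Projectivization.mk k (r x) (hr0 x)) := by
    refine continuous_mk_of_polynomial p q r hp0 hq0 hr0 fun e h hh => ?_
    obtain ⟨g, hg⟩ := triForm.exists_eval_eq hp hq hr hh
    simp only [hg]
    exact AffineZariski.isOpen_eval_ne_zero g
  refine ⟨le_antisymm hcont.le_induced ?_⟩
  rw [AffineZariski.isTopologicalBasis.eq_generateFrom]
  refine le_generateFrom ?_
  rintro _ ⟨g, rfl⟩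
  let D := g.totalDegree
  have hD : ∀ m ∈ g.support, ∀ s, m s ≤ D := fun m hm s =>
    (Finsupp.le_degree s m).trans (le_totalDegree (p := g) hm)
  let G : M₁ × M₂ × M₃ → k := ∑ m ∈ g.support,
    coeff m g • ∏ s, (num s ^ m s * den s ^ (D - m s))
  have hG : G ∈ triForm k M₁ M₂ M₃ (∑ s, D • e s) := by
    refine Submodule.sum_mem _ fun m hm => Submodule.smul_mem _ _ ?_
    refine SetLike.prod_mem_graded _ _ _ fun s _ => ?_
    have h2 : D • e s = m s • e s + (D - m s) • e s := by
      rw [← add_smul, Nat.add_sub_cancel' (hD m hm s)]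
    rw [h2]
    exact SetLike.mul_mem_graded (SetLike.pow_mem_graded _ (hnum s))
      (SetLike.pow_mem_graded _ (hden s))
  refine isOpen_induced_iff.mpr ⟨_, isOpen_triNonvanishing hG, ?_⟩
  ext x
  rw [Set.mem_preimage, mk_mem_triNonvanishing hG, Set.mem_ofPred_eq]
  suffices G (p x, q x, r x) = eval x g by rw [this]
  simp [G, hnum_eq, hden_eq, eval_eq']

end TriForm

section Plucker

open CliffordAlgebra in
/-- The Plücker coordinates on the exterior square of `k^{n+1}`. -/
def plucker (i j : Fin (n + 1)) : ⋀[k]^2 (Fin (n + 1) → k) →ₗ[k] k :=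
  (ExteriorAlgebra.algebraMapInv (R := k) (M := Fin (n + 1) → k)).toLinearMap ∘ₗ
    contractLeft (Q := (0 : QuadraticForm k (Fin (n + 1) → k))) (LinearMap.proj j) ∘ₗ
    contractLeft (Q := (0 : QuadraticForm k (Fin (n + 1) → k))) (LinearMap.proj i) ∘ₗ
    (⋀[k]^2 (Fin (n + 1) → k)).subtype

lemma contractLeft_ι_mul_ι (l : Module.Dual k (Fin (n + 1) → k)) (v w : Fin (n + 1) → k) :
    CliffordAlgebra.contractLeft (Q := (0 : QuadraticForm k (Fin (n + 1) → k))) l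
      (ExteriorAlgebra.ι k v * ExteriorAlgebra.ι k w) =
      ExteriorAlgebra.ι k (l v • w - l w • v) := by
  rw [ExteriorAlgebra.ι, CliffordAlgebra.contractLeft_ι_mul, CliffordAlgebra.contractLeft_ι,
    ← Algebra.commutes, ← Algebra.smul_def, map_sub, map_smul, map_smul]

@[simp]
lemma plucker_wedge (i j : Fin (n + 1)) (v w : Fin (n + 1) → k) :
    plucker i j (wedge k n v w) = v i * w j - w i * v j := by
  simp only [plucker, LinearMap.comp_apply, Submodule.subtype_apply, wedge, contractLeft_ι_mul_ι]
  rw [ExteriorAlgebra.ι, CliffordAlgebra.contractLeft_ι]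
  simp [ExteriorAlgebra.algebraMapInv]

lemma wedge_eq_ιMulti (v w : Fin (n + 1) → k) :
    wedge k n v w = exteriorPower.ιMulti k 2 ![v, w] := by
  ext
  simp [wedge, ExteriorAlgebra.ιMulti_apply]

lemma wedge_smul_add (p u : Fin (n + 1) → k) (c a b : k) :
    wedge k n (c • p) (a • u + b • p) = (c * a) • wedge k n p u := by
  ext
  simp [wedge, mul_add, smul_smul, mul_comm]

lemma span_wedge :
    Submodule.span k (Set.range fun v : (Fin (n + 1) → k) × (Fin (n + 1) → k) =>
      wedge k n v.1 v.2) = ⊤ := by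
  rw [← exteriorPower.ιMulti_span]
  congr 1
  ext ω
  constructor
  · rintro ⟨v, rfl⟩
    exact ⟨_, (wedge_eq_ιMulti _ _).symm⟩
  · rintro ⟨v, rfl⟩
    refine ⟨(v 0, v 1), ?_⟩
    dsimp only
    rw [wedge_eq_ιMulti]
    congr 1
    ext i
    fin_cases i <;> rfl

/-- The contraction of a bivector against a coordinate function is its row of Plücker
coordinates. -/
lemma contractLeft_proj_coe (i : Fin (n + 1)) (ω : ⋀[k]^2 (Fin (n + 1) → k)) :
    CliffordAlgebra.contractLeft (Q := (0 : QuadraticForm k (Fin (n + 1) → k)))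
      (LinearMap.proj i) (ω : ExteriorAlgebra k (Fin (n + 1) → k)) =
      ExteriorAlgebra.ι k (fun j => plucker i j ω) := by
  have hω : ω ∈ Submodule.span k (Set.range fun v : (Fin (n + 1) → k) × (Fin (n + 1) → k) =>
      wedge k n v.1 v.2) := span_wedge (k := k) (n := n) ▸ Submodule.mem_top
  induction hω using Submodule.span_induction with
  | mem ω h =>
    obtain ⟨⟨v, w⟩, rfl⟩ := h
    simp only [plucker_wedge]
    simp only [wedge, contractLeft_ι_mul_ι]
    congr 1
  | zero =>
    simp only [map_zero, ZeroMemClass.coe_zero]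
    exact (map_zero (ExteriorAlgebra.ι k)).symm
  | add x y _ _ hx hy =>
    simp only [map_add, Submodule.coe_add, hx, hy]
    exact (map_add (ExteriorAlgebra.ι k) _ _).symm
  | smul a x _ hx =>
    simp only [map_smul, Submodule.coe_smul, hx]
    exact (map_smul (ExteriorAlgebra.ι k) _ _).symm

/-- A bivector killed by a nonzero vector `p` is divisible by `p`. -/
lemma smul_eq_wedge_plucker {p : Fin (n + 1) → k} {ω : ⋀[k]^2 (Fin (n + 1) → k)}
    (h : ExteriorAlgebra.ι k p * (ω : ExteriorAlgebra k (Fin (n + 1) → k)) = 0)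
    (i : Fin (n + 1)) : p i • ω = wedge k n p (fun j => plucker i j ω) := by
  have h1 := congrArg (CliffordAlgebra.contractLeft
    (Q := (0 : QuadraticForm k (Fin (n + 1) → k))) (LinearMap.proj i)) h
  rw [ExteriorAlgebra.ι, CliffordAlgebra.contractLeft_ι_mul, map_zero, contractLeft_proj_coe,
    sub_eq_zero] at h1
  exact Subtype.ext h1

lemma ι_mul_wedge (p u : Fin (n + 1) → k) :
    ExteriorAlgebra.ι k p * (wedge k n p u : ExteriorAlgebra k (Fin (n + 1) → k)) = 0 := by
  simp [wedge, ← mul_assoc]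

@[simp]
lemma plucker_self (i : Fin (n + 1)) (ω : ⋀[k]^2 (Fin (n + 1) → k)) : plucker i i ω = 0 := by
  simp [plucker, CliffordAlgebra.contractLeft_contractLeft]

lemma left_ne_zero_of_wedge_ne_zero {p u : Fin (n + 1) → k} (h : wedge k n p u ≠ 0) : p ≠ 0 := by
  rintro rfl
  exact h (by ext; simp [wedge])

lemma exists_plucker_ne_zero {p : Fin (n + 1) → k} {ω : ⋀[k]^2 (Fin (n + 1) → k)} (hω : ω ≠ 0)
    (h : ExteriorAlgebra.ι k p * (ω : ExteriorAlgebra k (Fin (n + 1) → k)) = 0)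
    {i : Fin (n + 1)} (hi : p i ≠ 0) : ∃ j, plucker i j ω ≠ 0 := by
  by_contra! hj
  have := smul_eq_wedge_plucker h i
  simp only [hj] at this
  refine smul_ne_zero hi hω (this.trans ?_)
  ext
  have : (fun _ => 0 : Fin (n + 1) → k) = 0 := rfl
  simp [wedge, this]

end Plucker

section LineRestriction

variable {R ι : Type*} [CommRing R]

/-- The restriction of a polynomial to the line spanned by `p` and `u`, as a binary form. -/
def lineRestriction (p u : ι → R) : MvPolynomial ι R →ₐ[R] MvPolynomial (Fin 2) R :=
  aeval fun s => C (p s) * X 0 + C (u s) * X 1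

@[simp]
lemma lineRestriction_X (p u : ι → R) (s : ι) :
    lineRestriction p u (X s) = C (p s) * X 0 + C (u s) * X 1 := by
  simp [lineRestriction]

lemma isHomogeneous_C_mul_X_add (a b : R) (i j : ι) :
    (C a * X i + C b * X j : MvPolynomial ι R).IsHomogeneous 1 :=
  ((isHomogeneous_C_mul_X a i).add (isHomogeneous_C_mul_X b j))

lemma isHomogeneous_lineRestriction (p u : ι → R) {f : MvPolynomial ι R} (hf : f.IsHomogeneous d) :
    (lineRestriction p u f).IsHomogeneous d := by
  have := hf.aeval (fun s => C (p s) * X (0 : Fin 2) + C (u s) * X 1)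
    (fun s => isHomogeneous_C_mul_X_add (p s) (u s) 0 1)
  rwa [one_mul] at this

lemma lineRestriction_smul_add (p u : ι → R) (c a b : R) (f : MvPolynomial ι R) :
    lineRestriction (c • p) (a • u + b • p) f =
      aeval ![C c * X 0 + C b * X 1, C a * X 1] (lineRestriction p u f) := by
  rw [← AlgHom.comp_apply]
  congr 1
  ext1 s
  simp
  ring

/-- The exponent of `X 0 ^ (d - j) * X 1 ^ j`. -/
def binaryExponent (d j : ℕ) : Fin 2 →₀ ℕ := Finsupp.single 0 (d - j) + Finsupp.single 1 j

lemma eq_binaryExponent_iff {m : Fin 2 →₀ ℕ} (hm : m.degree = d) (j : ℕ) :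
    m = binaryExponent d j ↔ m 1 = j := by
  have h2 : m 0 + m 1 = d := by rw [← hm, Finsupp.degree_eq_sum, Fin.sum_univ_two]
  constructor
  · rintro rfl
    simp [binaryExponent]
  · rintro rfl
    ext s
    fin_cases s <;> simp [binaryExponent]
    omega

lemma coeff_aeval_one_X {g : MvPolynomial (Fin 2) R} (hg : g.IsHomogeneous d) {j : ℕ}
    (hj : j ≤ d) : (aeval ![1, Polynomial.X] g : Polynomial R).coeff j =
      coeff (binaryExponent d j) g := by
  rw [aeval_def, eval₂_eq']
  simp only [Fin.prod_univ_two, Matrix.cons_val_zero, Matrix.cons_val_one, one_pow, one_mul,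
    Polynomial.finsetSum_coeff, Polynomial.algebraMap_eq, Polynomial.coeff_C_mul_X_pow]
  rw [Finset.sum_eq_single (binaryExponent d j)]
  · simp [binaryExponent]
  · intro m hm hne
    rw [if_neg]
    rintro rfl
    refine hne ((eq_binaryExponent_iff ?_ _).2 rfl)
    rw [← hg (mem_support_iff.1 hm), Finsupp.degree_eq_weight_one]
    rfl
  · intro h
    simp [notMem_support_iff.1 h]

lemma coeff_aeval_line (p u : ι → R) {f : MvPolynomial ι R} (hf : f.IsHomogeneous d) {j : ℕ}
    (hj : j ≤ d) :
    (aeval (fun i => (Polynomial.C (p i) + Polynomial.X * Polynomial.C (u i))) f).coeff j =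
      coeff (binaryExponent d j) (lineRestriction p u f) := by
  rw [← coeff_aeval_one_X (isHomogeneous_lineRestriction p u hf) hj, ← AlgHom.comp_apply]
  congr 2
  ext1 s
  rw [aeval_X, AlgHom.comp_apply, lineRestriction_X]
  simp

/-- The form `f` restricts on the line spanned by `p` and `u` to a form of degree `d` vanishing to
order at least `d` at `p`. -/
def VanishesToOrder (d : ℕ) (p u : ι → R) (f : MvPolynomial ι R) : Prop :=
  ∀ j < d, coeff (binaryExponent d j) (lineRestriction p u f) = 0

lemma vanishesToOrder_iff (p u : ι → R) {f : MvPolynomial ι R} (hf : f.IsHomogeneous d) :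
    VanishesToOrder d p u f ↔ ∃ c, lineRestriction p u f = C c * X 1 ^ d := by
  have hg := isHomogeneous_lineRestriction p u hf
  constructor
  · intro h
    refine ⟨coeff (binaryExponent d d) (lineRestriction p u f), ?_⟩
    ext m
    rw [C_mul_X_pow_eq_monomial, coeff_monomial]
    have hd : Finsupp.single 1 d = binaryExponent d d := by simp [binaryExponent]
    rw [hd]
    split_ifs with hm
    · rw [hm]
    · by_contra hne
      have hdeg : m.degree = d := by
        rw [← hg hne, Finsupp.degree_eq_weight_one]; rfl
      have hm1 := (eq_binaryExponent_iff hdeg (m 1)).2 rfl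
      refine hne ?_
      rw [hm1]
      refine h _ (lt_of_le_of_ne ?_ ?_)
      · exact hdeg ▸ Finsupp.le_degree 1 m
      · intro h1
        exact hm (h1 ▸ hm1.symm)
  · rintro ⟨c, hc⟩ j hj
    rw [hc, C_mul_X_pow_eq_monomial, coeff_monomial, if_neg]
    intro h
    have := DFunLike.congr_fun h 1
    simp [binaryExponent] at this
    omega

lemma VanishesToOrder.smul_add {p u : ι → R} {f : MvPolynomial ι R} (hf : f.IsHomogeneous d)
    (h : VanishesToOrder d p u f) (c a b : R) : VanishesToOrder d (c • p) (a • u + b • p) f := by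
  obtain ⟨x, hx⟩ := (vanishesToOrder_iff p u hf).1 h
  refine (vanishesToOrder_iff _ _ hf).2 ⟨x * a ^ d, ?_⟩
  rw [lineRestriction_smul_add, hx]
  simp [algebraMap_eq, mul_pow, mul_assoc]

end LineRestriction

section Membership

/-- Two pairs of vectors with proportional first vectors and proportional wedges span the same
flag. -/
lemma exists_smul_add_of_wedge_eq {p u p' u' : Fin (n + 1) → k} {c a : k} (hp : p ≠ 0)
    (hc : c ≠ 0) (h : p' = c • p) (h2 : wedge k n p' u' = a • wedge k n p u) :
    ∃ a b : k, u' = a • u + b • p := by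
  obtain ⟨i, hi⟩ := Function.ne_iff.1 hp
  simp only [Pi.zero_apply] at hi
  refine ⟨a / c, (u' i - a / c * u i) / p i, ?_⟩
  ext j
  have := congrArg (plucker i j) h2
  simp only [map_smul, plucker_wedge, h, Pi.smul_apply, smul_eq_mul, Pi.add_apply] at this ⊢
  field_simp
  linear_combination this

lemma mk_wedge_mem_Tnd_iff {p u : Fin (n + 1) → k} (h : wedge k n p u ≠ 0)
    {f : homogeneousSubmodule (Fin (n + 1)) k d} (hf : f ≠ 0) :
    (Projectivization.mk k p (left_ne_zero_of_wedge_ne_zero h),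
      Projectivization.mk k (wedge k n p u) h, Projectivization.mk k f hf) ∈ Tnd k n d ↔
      VanishesToOrder d p u (f : MvPolynomial (Fin (n + 1)) k) := by
  constructor
  · rintro ⟨-, -, h3⟩ j hj
    rw [← coeff_aeval_line p u f.2 hj.le]
    exact h3 p _ rfl u h rfl f hf rfl j hj
  · intro hv
    refine ⟨⟨p, u, h, rfl⟩, ?_, ?_⟩
    · intro p' hp' ω hω h1 h2
      obtain ⟨a, rfl⟩ := (Projectivization.mk_eq_mk_iff' k _ _ _ _).1 h1
      obtain ⟨b, rfl⟩ := (Projectivization.mk_eq_mk_iff' k _ _ _ _).1 h2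
      simp only [map_smul, Submodule.coe_smul]
      rw [smul_mul_smul_comm, ι_mul_wedge, smul_zero]
    · intro p' hp' h1 u' hw h2 f' hf' h3 j hj
      obtain ⟨a, ha⟩ := (Projectivization.mk_eq_mk_iff' k _ _ _ _).1 h1
      obtain ⟨b, hb⟩ := (Projectivization.mk_eq_mk_iff' k _ _ _ _).1 h2
      obtain ⟨e, he⟩ := (Projectivization.mk_eq_mk_iff' k _ _ _ _).1 h3
      have ha0 : a ≠ 0 := by
        rintro rfl
        exact hp' (by simpa using ha.symm)
      obtain ⟨x, y, rfl⟩ := exists_smul_add_of_wedge_eq (left_ne_zero_of_wedge_ne_zero h) ha0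
        ha.symm hb.symm
      rw [coeff_aeval_line _ _ f'.2 hj.le, ← ha, ← he, Submodule.coe_smul, map_smul, coeff_smul,
        hv.smul_add f.2 a x y j hj, smul_zero]

lemma eq_wedge_of_ι_mul_eq_zero {p : Fin (n + 1) → k} {ω : ⋀[k]^2 (Fin (n + 1) → k)}
    (h : ExteriorAlgebra.ι k p * (ω : ExteriorAlgebra k (Fin (n + 1) → k)) = 0)
    {i : Fin (n + 1)} (hi : p i ≠ 0) :
    wedge k n p ((p i)⁻¹ • fun j => plucker i j ω) = ω := by
  have h1 : wedge k n p ((p i)⁻¹ • fun j => plucker i j ω) =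
      (p i)⁻¹ • wedge k n p (fun j => plucker i j ω) := by
    ext
    simp [wedge]
  rw [h1, ← smul_eq_wedge_plucker h i, inv_smul_smul₀ hi]

lemma ι_mul_eq_zero_of_mk_mem_Tnd {p : Fin (n + 1) → k} (hp : p ≠ 0)
    {ω : ⋀[k]^2 (Fin (n + 1) → k)} (hω : ω ≠ 0)
    {f : homogeneousSubmodule (Fin (n + 1)) k d} (hf : f ≠ 0)
    (h : (Projectivization.mk k p hp, Projectivization.mk k ω hω, Projectivization.mk k f hf) ∈
      Tnd k n d) :
    ExteriorAlgebra.ι k p * (ω : ExteriorAlgebra k (Fin (n + 1) → k)) = 0 :=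
  h.2.1 p hp ω hω rfl rfl

lemma mk_mem_Tnd_iff {p : Fin (n + 1) → k} (hp : p ≠ 0) {ω : ⋀[k]^2 (Fin (n + 1) → k)}
    (hω : ω ≠ 0) {f : homogeneousSubmodule (Fin (n + 1)) k d} (hf : f ≠ 0) :
    (Projectivization.mk k p hp, Projectivization.mk k ω hω, Projectivization.mk k f hf) ∈
      Tnd k n d ↔
      ExteriorAlgebra.ι k p * (ω : ExteriorAlgebra k (Fin (n + 1) → k)) = 0 ∧
      ∀ i, p i ≠ 0 → VanishesToOrder d p ((p i)⁻¹ • fun j => plucker i j ω)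
        (f : MvPolynomial (Fin (n + 1)) k) := by
  have key : ∀ i, p i ≠ 0 → ExteriorAlgebra.ι k p *
      (ω : ExteriorAlgebra k (Fin (n + 1) → k)) = 0 →
      ((Projectivization.mk k p hp, Projectivization.mk k ω hω, Projectivization.mk k f hf) ∈
      Tnd k n d ↔ VanishesToOrder d p ((p i)⁻¹ • fun j => plucker i j ω)
        (f : MvPolynomial (Fin (n + 1)) k)) := by
    intro i hi h
    have hw := eq_wedge_of_ι_mul_eq_zero h hi
    rw [← mk_wedge_mem_Tnd_iff (by rwa [hw]) hf]
    simp only [hw]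
  constructor
  · intro h
    have h1 := ι_mul_eq_zero_of_mk_mem_Tnd hp hω hf h
    exact ⟨h1, fun i hi => (key i hi h1).1 h⟩
  · rintro ⟨h1, h2⟩
    obtain ⟨i, hi⟩ := Function.ne_iff.1 hp
    exact (key i hi h1).2 (h2 i hi)

end Membership

section Forms

instance finiteDimensional_homogeneousSubmodule :
    FiniteDimensional k (homogeneousSubmodule (Fin (n + 1)) k d) :=
  Module.Finite.iff_fg.2 (homogeneousSubmodule_fg _ _ d)

variable {A : Type} [CommRing A] [Algebra k A]

/-- Polynomials whose coefficients lie in a graded piece of the coefficient ring are graded. -/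
instance gradedMonoid_coeffsIn {Γ : Type} [AddCommMonoid Γ] (𝒜 : Γ → Submodule k A)
    [SetLike.GradedMonoid 𝒜] (τ : Type) :
    SetLike.GradedMonoid fun e => coeffsIn τ (𝒜 e) where
  one_mem := one_coeffsIn.2 SetLike.GradedOne.one_mem
  mul_mem := by
    intro a b f g hf hg m
    classical
    rw [coeff_mul]
    exact Submodule.sum_mem _ fun x _ => SetLike.mul_mem_graded (hf _) (hg _)

lemma degree_eq_of_mem_support {f : MvPolynomial (Fin (n + 1)) A} (hf : f.IsHomogeneous d)
    {m : Fin (n + 1) →₀ ℕ} (hm : m ∈ f.support) : m.degree = d := by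
  rw [← hf (mem_support_iff.1 hm), Finsupp.degree_eq_weight_one]
  rfl

lemma mem_finsuppAntidiag_univ {m : Fin (n + 1) →₀ ℕ} :
    m ∈ Finset.finsuppAntidiag Finset.univ d ↔ m.degree = d := by
  simp [Finset.mem_finsuppAntidiag, Finsupp.degree_eq_sum]

/-- The coefficient at `m`, as a linear functional on forms of degree `d`. -/
def coeffForm (m : Fin (n + 1) →₀ ℕ) : homogeneousSubmodule (Fin (n + 1)) k d →ₗ[k] k :=
  lcoeff k m ∘ₗ (homogeneousSubmodule (Fin (n + 1)) k d).subtype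

@[simp]
lemma coeffForm_apply (m : Fin (n + 1) →₀ ℕ) (f : homogeneousSubmodule (Fin (n + 1)) k d) :
    coeffForm m f = coeff m (f : MvPolynomial (Fin (n + 1)) k) := rfl

variable {M₁ M₂ : Type} [AddCommGroup M₁] [Module k M₁] [AddCommGroup M₂]
    [Module k M₂] [FiniteDimensional k M₁] [FiniteDimensional k M₂]

lemma triForm.coeff_aeval_mem {τ : Type} {e : ℕ × ℕ × ℕ}
    (G : Fin (n + 1) → MvPolynomial τ
      (M₁ × M₂ × homogeneousSubmodule (Fin (n + 1)) k d → k))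
    (hG : ∀ s, G s ∈ coeffsIn τ (triForm k M₁ M₂ (homogeneousSubmodule (Fin (n + 1)) k d) e))
    (m : τ →₀ ℕ) :
    (fun v => coeff m (aeval (fun s => map (Pi.evalRingHom (fun _ => k) v) (G s))
      (v.2.2 : MvPolynomial (Fin (n + 1)) k))) ∈
      triForm k M₁ M₂ (homogeneousSubmodule (Fin (n + 1)) k d) ((0, 0, 1) + d • e) := by
  have key : (fun v => coeff m (aeval (fun s => map (Pi.evalRingHom (fun _ => k) v) (G s))
      (v.2.2 : MvPolynomial (Fin (n + 1)) k))) =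
      ∑ x ∈ Finset.finsuppAntidiag Finset.univ d,
        (fun v : M₁ × M₂ × homogeneousSubmodule (Fin (n + 1)) k d => coeffForm x v.2.2) *
          coeff m (∏ s, G s ^ (x s : ℕ)) := by
    ext v
    have h1 : ∀ x : Fin (n + 1) →₀ ℕ, coeff m (∏ s, G s ^ x s) v =
        coeff m (∏ s, map (Pi.evalRingHom (fun _ => k) v) (G s) ^ x s) := by
      intro x
      have := coeff_map (Pi.evalRingHom (fun _ => k) v) (∏ s, G s ^ x s) m
      rw [map_prod] at this
      simp only [map_pow] at this
      exact this.symm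
    simp only [Finset.sum_apply, Pi.mul_apply, h1, coeffForm_apply]
    rw [aeval_def, eval₂_eq', coeff_sum]
    simp only [algebraMap_eq, coeff_C_mul]
    refine Finset.sum_subset ?_ ?_
    · intro x hx
      exact mem_finsuppAntidiag_univ.2 (degree_eq_of_mem_support v.2.2.2 hx)
    · intro x _ hx
      rw [notMem_support_iff.1 hx, zero_mul]
  rw [key]
  refine Submodule.sum_mem _ fun x hx => SetLike.mul_mem_graded (triForm.thd_mem _) ?_
  have hd : d • e = ∑ s, x s • e := by
    rw [← Finset.sum_smul, ← Finsupp.degree_eq_sum, mem_finsuppAntidiag_univ.1 hx]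
  rw [hd]
  exact SetLike.prod_mem_graded
    (A := fun e => coeffsIn τ (triForm k M₁ M₂ (homogeneousSubmodule (Fin (n + 1)) k d) e))
    _ _ (fun s _ => SetLike.pow_mem_graded (A := fun e => coeffsIn τ
      (triForm k M₁ M₂ (homogeneousSubmodule (Fin (n + 1)) k d) e)) _ (hG s)) m

end Forms

section Closed

/-- Triples of representatives of points of the ambient space. -/
abbrev RepTriple (k : Type) [Field k] (n d : ℕ) :=
  (Fin (n + 1) → k) × ⋀[k]^2 (Fin (n + 1) → k) × homogeneousSubmodule (Fin (n + 1)) k d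

/-- The trihomogeneous functions on representatives of points of the ambient space. -/
abbrev repForm (k : Type) [Field k] (n d : ℕ) (e : ℕ × ℕ × ℕ) : Submodule k (RepTriple k n d → k) :=
  triForm k (Fin (n + 1) → k) (⋀[k]^2 (Fin (n + 1) → k))
    (homogeneousSubmodule (Fin (n + 1)) k d) e

lemma triForm.coord_mem (i : Fin (n + 1)) :
    (fun v : RepTriple k n d => v.1 i) ∈ repForm k n d (1, 0, 0) :=
  triForm.fst_mem (M₁ := Fin (n + 1) → k) (M₂ := ⋀[k]^2 (Fin (n + 1) → k))
    (M₃ := homogeneousSubmodule (Fin (n + 1)) k d) (LinearMap.proj (R := k) (φ := fun _ => k) i)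

lemma triForm.plucker_mem (i j : Fin (n + 1)) :
    (fun v : RepTriple k n d => plucker i j v.2.1) ∈ repForm k n d (0, 1, 0) :=
  triForm.snd_mem (M₁ := Fin (n + 1) → k) (M₂ := ⋀[k]^2 (Fin (n + 1) → k))
    (M₃ := homogeneousSubmodule (Fin (n + 1)) k d) (plucker i j)

lemma triForm.coord_mul_plucker_mem (s i j : Fin (n + 1)) :
    (fun v : RepTriple k n d => v.1 s * plucker i j v.2.1) ∈ repForm k n d (1, 1, 0) :=
  SetLike.mul_mem_graded (triForm.coord_mem s) (triForm.plucker_mem i j)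

lemma triForm.wedge_mem (μ : Module.Dual k (ExteriorAlgebra k (Fin (n + 1) → k))) :
    (fun v : RepTriple k n d =>
      μ (ExteriorAlgebra.ι k v.1 * (v.2.1 : ExteriorAlgebra k (Fin (n + 1) → k)))) ∈
      repForm k n d (1, 1, 0) := by
  have : (fun v : RepTriple k n d =>
      μ (ExteriorAlgebra.ι k v.1 * (v.2.1 : ExteriorAlgebra k (Fin (n + 1) → k)))) =
      ∑ s, (fun v : RepTriple k n d => v.1 s) * fun v => (μ ∘ₗ LinearMap.mulLeft k
        (ExteriorAlgebra.ι k (Pi.single s 1)) ∘ₗ (⋀[k]^2 (Fin (n + 1) → k)).subtype) v.2.1 := by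
    ext v
    conv_lhs => rw [pi_eq_sum_univ' v.1]
    simp only [map_sum, map_smul, Finset.sum_mul, smul_mul_assoc, Finset.sum_apply, Pi.mul_apply,
      smul_eq_mul]
    rfl
  rw [this]
  exact Submodule.sum_mem _ fun s _ =>
    SetLike.mul_mem_graded (triForm.coord_mem s) (triForm.snd_mem _)

/-- The coefficients of the restriction of `f` to the line with Plücker coordinates `ω`. -/
def lineCoeff (i j : Fin (n + 1)) (l : ℕ) (v : RepTriple k n d) : k :=
  coeff (binaryExponent d l) (lineRestriction (plucker i j v.2.1 • v.1)
    (v.1 i • fun s => plucker i s v.2.1) (v.2.2 : MvPolynomial (Fin (n + 1)) k))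

lemma triForm.lineCoeff_mem (i j : Fin (n + 1)) (l : ℕ) :
    lineCoeff i j l ∈ repForm k n d ((0, 0, 1) + d • (1, 1, 0)) := by
  have := triForm.coeff_aeval_mem (k := k) (n := n) (d := d)
    (M₁ := Fin (n + 1) → k) (M₂ := ⋀[k]^2 (Fin (n + 1) → k)) (τ := Fin 2)
    (e := (1, 1, 0))
    (fun s => C (fun v => v.1 s * plucker i j v.2.1) * X 0 +
      C (fun v => v.1 i * plucker i s v.2.1) * X 1) (fun s => Submodule.add_mem _ ?_ ?_)
    (binaryExponent d l)
  · convert this using 2 with v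
    simp [lineCoeff, lineRestriction, mul_comm]
  · exact mul_X_mem_coeffsIn.2 (C_mem_coeffsIn.2 (triForm.coord_mul_plucker_mem _ _ _))
  · exact mul_X_mem_coeffsIn.2 (C_mem_coeffsIn.2 (triForm.coord_mul_plucker_mem _ _ _))

lemma mk_mem_Tnd_iff_forms {v : RepTriple k n d} (h₁ : v.1 ≠ 0) (h₂ : v.2.1 ≠ 0) (h₃ : v.2.2 ≠ 0) :
    (Projectivization.mk k v.1 h₁, Projectivization.mk k v.2.1 h₂,
      Projectivization.mk k v.2.2 h₃) ∈ Tnd k n d ↔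
      (∀ μ : Module.Dual k (ExteriorAlgebra k (Fin (n + 1) → k)),
        μ (ExteriorAlgebra.ι k v.1 * (v.2.1 : ExteriorAlgebra k (Fin (n + 1) → k))) = 0) ∧
      ∀ i j l, l < d → v.1 i * plucker i j v.2.1 * lineCoeff i j l v = 0 := by
  rw [mk_mem_Tnd_iff, Module.forall_dual_apply_eq_zero_iff]
  refine and_congr_right fun h => ⟨fun H i j l hl => ?_, fun H i hi => ?_⟩
  · by_cases hi : v.1 i = 0
    · simp [hi]
    · have := (H i hi).smul_add v.2.2.2 (plucker i j v.2.1) (v.1 i * v.1 i) 0 l hl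
      rw [zero_smul, add_zero, smul_smul, mul_assoc, mul_inv_cancel₀ hi, mul_one] at this
      rw [lineCoeff, this, mul_zero]
  · obtain ⟨j, hj⟩ := exists_plucker_ne_zero h₂ h hi
    have hv : VanishesToOrder d (plucker i j v.2.1 • v.1) (v.1 i • fun s => plucker i s v.2.1)
        (v.2.2 : MvPolynomial (Fin (n + 1)) k) := fun l hl => by
      have := H i j l hl
      simpa [hi, hj, lineCoeff] using this
    have := hv.smul_add v.2.2.2 (plucker i j v.2.1)⁻¹ ((v.1 i)⁻¹ * (v.1 i)⁻¹) 0
    rwa [zero_smul, add_zero, smul_smul, smul_smul, inv_mul_cancel₀ hj, one_smul, mul_assoc,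
      inv_mul_cancel₀ hi, mul_one] at this

lemma isClosed_Tnd : IsClosed (Tnd k n d) := by
  have : (Tnd k n d) = (⋂ μ : Module.Dual k (ExteriorAlgebra k (Fin (n + 1) → k)),
      (triNonvanishing (k := k)
      (fun v : RepTriple k n d => μ (ExteriorAlgebra.ι k v.1 *
        (v.2.1 : ExteriorAlgebra k (Fin (n + 1) → k)))))ᶜ) ∩
      ⋂ (i) (j) (l) (_ : l < d), (triNonvanishing (k := k)
        (fun v : RepTriple k n d => v.1 i * plucker i j v.2.1 * lineCoeff i j l v))ᶜ := by
    ext ⟨P, L, F⟩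
    have := mk_mem_Tnd_iff_forms (v := (P.rep, L.rep, F.rep)) P.rep_nonzero L.rep_nonzero
      F.rep_nonzero
    simp only [Projectivization.mk_rep] at this
    rw [this]
    simp [triNonvanishing, or_iff_not_imp_left]
  rw [this]
  refine IsClosed.inter (isClosed_iInter fun μ => ?_) (isClosed_iInter fun i => isClosed_iInter
    fun j => isClosed_iInter fun l => isClosed_iInter fun _ => ?_)
  · exact (isOpen_triNonvanishing (triForm.wedge_mem μ)).isClosed_compl
  · exact (isOpen_triNonvanishing (SetLike.mul_mem_graded (triForm.coord_mul_plucker_mem i i j)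
      (triForm.lineCoeff_mem i j l))).isClosed_compl

end Closed

section Frame

variable {R S : Type} [CommRing R] [CommRing S]

/-- The linear substitution sending the coordinate vectors `e_i` and `e_j` to `p` and `u`, and the
others to their multiples by `c`. -/
def frameSubst (i j : Fin (n + 1)) (p u : Fin (n + 1) → R) (c : R) (s : Fin (n + 1)) :
    MvPolynomial (Fin (n + 1)) R :=
  C (p s) * X i + C (u s) * X j + if s = i ∨ s = j then 0 else C c * X s

/-- The inverse of the substitution `frameSubst i j p u 1` for a normalized frame. -/
def frameInv (i j : Fin (n + 1)) (p u : Fin (n + 1) → R) (s : Fin (n + 1)) :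
    MvPolynomial (Fin (n + 1)) R :=
  if s = i then X i else if s = j then X j - C (p j) * X i else
    X s - C (p s) * X i - C (u s) * (X j - C (p j) * X i)

lemma map_frameSubst (φ : R →+* S) (i j : Fin (n + 1)) (p u : Fin (n + 1) → R) (c : R)
    (s : Fin (n + 1)) : map φ (frameSubst i j p u c s) =
      frameSubst i j (fun t => φ (p t)) (fun t => φ (u t)) (φ c) s := by
  simp only [frameSubst]
  split_ifs <;> simp

lemma map_frameInv (φ : R →+* S) (i j : Fin (n + 1)) (p u : Fin (n + 1) → R)
    (s : Fin (n + 1)) : map φ (frameInv i j p u s) =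
      frameInv i j (fun t => φ (p t)) (fun t => φ (u t)) s := by
  simp only [frameInv]
  split_ifs <;> simp

/-- A pair of vectors whose coordinates at `i` and `j` are `(1, *)` and `(0, 1)`. -/
structure IsNormalFrame (i j : Fin (n + 1)) (p u : Fin (n + 1) → R) : Prop where
  ne : i ≠ j
  fst_left : p i = 1
  snd_left : u i = 0
  snd_right : u j = 1

/-- The change of coordinates attached to a normalized frame. -/
def frameEquiv {i j : Fin (n + 1)} {p u : Fin (n + 1) → R} (h : IsNormalFrame i j p u) :
    MvPolynomial (Fin (n + 1)) R ≃ₐ[R] MvPolynomial (Fin (n + 1)) R :=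
  AlgEquiv.ofAlgHom (aeval (frameSubst i j p u 1)) (aeval (frameInv i j p u))
    (by
      ext1 s
      have h1 := h.ne
      have h2 := h.ne.symm
      by_cases hi : s = i
      · subst hi
        simp [frameInv, frameSubst, h.fst_left, h.snd_left]
      · by_cases hj : s = j
        · subst hj
          simp [frameInv, frameSubst, h.fst_left, h.snd_left, h.snd_right, hi]
        · simp [frameInv, frameSubst, h.fst_left, h.snd_left, h.snd_right, hi, hj, algebraMap_eq]
          ring)
    (by
      ext1 s
      have h1 := h.ne
      have h2 := h.ne.symm
      by_cases hi : s = i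
      · subst hi
        simp [frameInv, frameSubst, h.fst_left, h.snd_left]
      · by_cases hj : s = j
        · subst hj
          simp [frameInv, frameSubst, h.snd_right, hi, algebraMap_eq]
        · simp [frameInv, frameSubst, h2, hi, hj, algebraMap_eq])

lemma frameEquiv_apply {i j : Fin (n + 1)} {p u : Fin (n + 1) → R} (h : IsNormalFrame i j p u)
    (f : MvPolynomial (Fin (n + 1)) R) : frameEquiv h f = aeval (frameSubst i j p u 1) f := rfl

lemma frameEquiv_symm_apply {i j : Fin (n + 1)} {p u : Fin (n + 1) → R}
    (h : IsNormalFrame i j p u) (f : MvPolynomial (Fin (n + 1)) R) :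
    (frameEquiv h).symm f = aeval (frameInv i j p u) f := rfl

lemma isHomogeneous_frameSubst (i j : Fin (n + 1)) (p u : Fin (n + 1) → R) (c : R)
    (s : Fin (n + 1)) : (frameSubst i j p u c s).IsHomogeneous 1 := by
  refine (isHomogeneous_C_mul_X_add _ _ _ _).add ?_
  split_ifs
  · exact isHomogeneous_zero _ _ _
  · exact isHomogeneous_C_mul_X _ _

lemma isHomogeneous_frameInv (i j : Fin (n + 1)) (p u : Fin (n + 1) → R)
    (s : Fin (n + 1)) : (frameInv i j p u s).IsHomogeneous 1 := by
  have hX : ∀ t : Fin (n + 1), (X t : MvPolynomial (Fin (n + 1)) R).IsHomogeneous 1 :=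
    isHomogeneous_X R
  have h1 := (hX j).sub (isHomogeneous_C_mul_X (p j) i)
  unfold frameInv
  split_ifs
  · exact hX i
  · exact h1
  · exact ((hX s).sub (isHomogeneous_C_mul_X (p s) i)).sub (h1.C_mul _)

lemma isHomogeneous_frameEquiv {i j : Fin (n + 1)} {p u : Fin (n + 1) → R}
    (h : IsNormalFrame i j p u) {f : MvPolynomial (Fin (n + 1)) R} (hf : f.IsHomogeneous d) :
    (frameEquiv h f).IsHomogeneous d := by
  have := hf.aeval _ (isHomogeneous_frameSubst i j p u 1)
  rwa [one_mul] at this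

lemma isHomogeneous_frameEquiv_symm {i j : Fin (n + 1)} {p u : Fin (n + 1) → R}
    (h : IsNormalFrame i j p u) {f : MvPolynomial (Fin (n + 1)) R} (hf : f.IsHomogeneous d) :
    ((frameEquiv h).symm f).IsHomogeneous d := by
  have := hf.aeval _ (isHomogeneous_frameInv i j p u)
  rwa [one_mul] at this

/-- The coefficients of a form in adapted coordinates see its restriction to the line. -/
lemma coeff_aeval_frameSubst {i j : Fin (n + 1)} (hij : i ≠ j) (p u : Fin (n + 1) → R) (c : R)
    (f : MvPolynomial (Fin (n + 1)) R) (l : ℕ) :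
    coeff (Finsupp.single i (d - l) + Finsupp.single j l) (aeval (frameSubst i j p u c) f) =
      coeff (binaryExponent d l) (lineRestriction p u f) := by
  have hinj : Function.Injective ![i, j] := by
    intro a b hab
    fin_cases a <;> fin_cases b <;> simp_all [eq_comm]
  have hcomp : (killCompl hinj).comp (aeval (frameSubst i j p u c)) = lineRestriction p u := by
    have hi : killCompl hinj (X i : MvPolynomial _ R) = X 0 := by
      simpa using killCompl_rename_app hinj (X 0 : MvPolynomial (Fin 2) R)
    have hj : killCompl hinj (X j : MvPolynomial _ R) = X 1 := by
      simpa using killCompl_rename_app hinj (X 1 : MvPolynomial (Fin 2) R)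
    ext1 s
    simp only [AlgHom.comp_apply, aeval_X, frameSubst, map_add, map_mul, killCompl_C, hi, hj,
      lineRestriction_X]
    rw [add_eq_left]
    split_ifs with hs
    · simp
    · have : killCompl hinj (X s : MvPolynomial _ R) = 0 := by
        rw [killCompl, aeval_X, dif_neg]
        rintro ⟨a, ha⟩
        fin_cases a
        · exact hs (Or.inl ha.symm)
        · exact hs (Or.inr ha.symm)
      simp [this]
  rw [← hcomp, AlgHom.comp_apply, coeff_killCompl]
  congr 1
  rw [binaryExponent, Finsupp.mapDomain_add, Finsupp.mapDomain_single, Finsupp.mapDomain_single]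
  rfl

end Frame

section Exponents

/-- The exponents, in coordinates adapted to the line, of the monomials of degree `d` vanishing to
order at least `d` at the point. -/
def goodExponents (d : ℕ) (i j : Fin (n + 1)) : Finset (Fin (n + 1) →₀ ℕ) :=
  (Finset.finsuppAntidiag Finset.univ d).filter fun m => m i + m j = d → m i = 0

lemma mem_goodExponents {i j : Fin (n + 1)} {m : Fin (n + 1) →₀ ℕ} :
    m ∈ goodExponents d i j ↔ m.degree = d ∧ (m i + m j = d → m i = 0) := by
  rw [goodExponents, Finset.mem_filter, mem_finsuppAntidiag_univ]

lemma eq_single_add_single {i j : Fin (n + 1)} (hij : i ≠ j) {m : Fin (n + 1) →₀ ℕ}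
    (hm : m.degree = d) (h : m i + m j = d) :
    m = Finsupp.single i (m i) + Finsupp.single j (m j) := by
  ext s
  by_cases hi : s = i
  · subst hi; simp [hij]
  by_cases hj : s = j
  · subst hj; simp [hij.symm]
  have : ∑ t, m t = m i + m j + ∑ t ∈ (Finset.univ.erase i).erase j, m t := by
    rw [add_assoc, Finset.add_sum_erase _ _ (by simp [hij.symm]),
      Finset.add_sum_erase _ _ (Finset.mem_univ _)]
  rw [← Finsupp.degree_eq_sum, hm, h] at this
  have h0 : ∑ t ∈ (Finset.univ.erase i).erase j, m t = 0 := by omega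
  rw [Finset.sum_eq_zero_iff] at h0
  simp [Ne.symm hi, Ne.symm hj, h0 s (by simp [hi, hj])]

lemma degree_single_add_single (i j : Fin (n + 1)) {l : ℕ} (hl : l ≤ d) :
    (Finsupp.single i (d - l) + Finsupp.single j l).degree = d := by
  rw [map_add, Finsupp.degree_single, Finsupp.degree_single, Nat.sub_add_cancel hl]

lemma card_finsuppAntidiag_univ :
    (Finset.finsuppAntidiag (Finset.univ : Finset (Fin (n + 1))) d).card = (n + d).choose d := by
  rw [Finset.card_finsuppAntidiag_nat_eq_choose]
  simp

lemma card_goodExponents {i j : Fin (n + 1)} (hij : i ≠ j) :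
    (goodExponents d i j).card = (n + d).choose d - d := by
  have h1 := Finset.card_filter_add_card_filter_not
    (s := Finset.finsuppAntidiag (Finset.univ : Finset (Fin (n + 1))) d)
    (fun m => m i + m j = d → m i = 0)
  have h2 : ((Finset.finsuppAntidiag (Finset.univ : Finset (Fin (n + 1))) d).filter
      fun m => ¬ (m i + m j = d → m i = 0)) = (Finset.range d).image
        fun l => Finsupp.single i (d - l) + Finsupp.single j l := by
    ext m
    rw [Finset.mem_filter, mem_finsuppAntidiag_univ, Finset.mem_image]
    constructor
    · rintro ⟨hm, h⟩
      push Not at h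
      refine ⟨m j, Finset.mem_range.2 (by omega), ?_⟩
      rw [show d - m j = m i by omega]
      exact (eq_single_add_single hij hm h.1).symm
    · rintro ⟨l, hl, rfl⟩
      rw [Finset.mem_range] at hl
      refine ⟨degree_single_add_single i j hl.le, ?_⟩
      simp [hij, hij.symm]
      omega
  rw [card_finsuppAntidiag_univ, h2, Finset.card_image_of_injective, Finset.card_range] at h1
  · rw [goodExponents]
    omega
  · intro a b hab
    simpa [hij, hij.symm] using DFunLike.congr_fun hab j

lemma single_mem_goodExponents {i j : Fin (n + 1)} (hij : i ≠ j) :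
    Finsupp.single j d ∈ goodExponents d i j := by
  simp [mem_goodExponents, hij]

lemma vanishesToOrder_iff_coeff {R : Type} [CommRing R] {i j : Fin (n + 1)}
    {p u : Fin (n + 1) → R}
    (h : IsNormalFrame i j p u) {f : MvPolynomial (Fin (n + 1)) R} (hf : f.IsHomogeneous d) :
    VanishesToOrder d p u f ↔ ∀ m ∉ goodExponents d i j, coeff m (frameEquiv h f) = 0 := by
  simp only [VanishesToOrder, ← coeff_aeval_frameSubst h.ne p u 1, ← frameEquiv_apply h]
  constructor
  · intro H m hm
    by_contra hne
    have hd := degree_eq_of_mem_support (isHomogeneous_frameEquiv h hf) (mem_support_iff.2 hne)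
    rw [mem_goodExponents] at hm
    push Not at hm
    obtain ⟨h1, h2⟩ := hm hd
    rw [eq_single_add_single h.ne hd h1, show m i = d - m j by omega] at hne
    exact hne (H (m j) (by omega))
  · intro H l hl
    refine H _ fun hm => ?_
    have := (mem_goodExponents.1 hm).2
    simp [h.ne, h.ne.symm] at this
    omega

end Exponents

section Fibers

lemma IsNormalFrame.wedge_ne_zero {i j : Fin (n + 1)} {p u : Fin (n + 1) → k}
    (h : IsNormalFrame i j p u) : wedge k n p u ≠ 0 := by
  intro h0
  have := congrArg (plucker i j) h0
  simp [h.fst_left, h.snd_left, h.snd_right] at this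

lemma IsNormalFrame.fst_ne_zero {i j : Fin (n + 1)} {p u : Fin (n + 1) → k}
    (h : IsNormalFrame i j p u) : p ≠ 0 :=
  left_ne_zero_of_wedge_ne_zero h.wedge_ne_zero

lemma exists_isNormalFrame {P : Projectivization k (Fin (n + 1) → k)}
    {L : Projectivization k (⋀[k]^2 (Fin (n + 1) → k))} (h : Incident k n P L)
    {i j : Fin (n + 1)} (hi : P.rep i ≠ 0) (hj : plucker i j L.rep ≠ 0) :
    ∃ (p u : Fin (n + 1) → k) (hf : IsNormalFrame i j p u),
      P = Projectivization.mk k p hf.fst_ne_zero ∧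
        L = Projectivization.mk k (wedge k n p u) hf.wedge_ne_zero := by
  have h0 := h P.rep P.rep_nonzero L.rep L.rep_nonzero P.mk_rep L.mk_rep
  have hf : IsNormalFrame i j ((P.rep i)⁻¹ • P.rep)
      ((plucker i j L.rep)⁻¹ • (fun s => plucker i s L.rep) + (0 : k) • P.rep) := by
    refine ⟨?_, ?_, ?_, ?_⟩
    · rintro rfl
      simp at hj
    · simp [hi]
    · simp
    · simp [hj]
  refine ⟨_, _, hf, ?_, ?_⟩
  · conv_lhs => rw [← P.mk_rep]
    rw [Projectivization.mk_eq_mk_iff']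
    exact ⟨P.rep i, by rw [smul_smul, mul_inv_cancel₀ hi, one_smul]⟩
  · conv_lhs => rw [← L.mk_rep]
    rw [Projectivization.mk_eq_mk_iff']
    refine ⟨plucker i j L.rep, ?_⟩
    rw [wedge_smul_add, ← smul_eq_wedge_plucker h0, smul_smul, smul_smul]
    field_simp
    simp

/-- Some affine chart contains a given incident pair. -/
lemma exists_rep_ne_zero {P : Projectivization k (Fin (n + 1) → k)}
    {L : Projectivization k (⋀[k]^2 (Fin (n + 1) → k))} (h : Incident k n P L) :
    ∃ i j, P.rep i ≠ 0 ∧ plucker i j L.rep ≠ 0 := by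
  have h0 := h P.rep P.rep_nonzero L.rep L.rep_nonzero P.mk_rep L.mk_rep
  obtain ⟨i, hi⟩ := Function.ne_iff.1 P.rep_nonzero
  obtain ⟨j, hj⟩ := exists_plucker_ne_zero L.rep_nonzero h0 hi
  exact ⟨i, j, hi, hj⟩

/-- The forms vanishing to order at least `d` at `p` along the line spanned by `p` and `u`. -/
def vanishingForms (d : ℕ) (p u : Fin (n + 1) → k) :
    Submodule k (homogeneousSubmodule (Fin (n + 1)) k d) where
  carrier := {f | VanishesToOrder d p u (f : MvPolynomial (Fin (n + 1)) k)}
  zero_mem' j _ := by simp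
  add_mem' {f g} hf hg j hj := by simp [hf j hj, hg j hj]
  smul_mem' c f hf j hj := by simp [hf j hj]

/-- The forms with prescribed coefficients in adapted coordinates. -/
def formOfCoeffs {R : Type} [CommRing R] {i j : Fin (n + 1)} {p u : Fin (n + 1) → R}
    (h : IsNormalFrame i j p u) (c : goodExponents d i j → R) : MvPolynomial (Fin (n + 1)) R :=
  (frameEquiv h).symm (∑ m, monomial m.1 (c m))

lemma isHomogeneous_formOfCoeffs {R : Type} [CommRing R] {i j : Fin (n + 1)}
    {p u : Fin (n + 1) → R} (h : IsNormalFrame i j p u) (c : goodExponents d i j → R) :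
    (formOfCoeffs h c).IsHomogeneous d :=
  isHomogeneous_frameEquiv_symm h (IsHomogeneous.sum _ _ _ fun m _ =>
    isHomogeneous_monomial _ (mem_goodExponents.1 m.2).1)

lemma coeff_formOfCoeffs {R : Type} [CommRing R] {i j : Fin (n + 1)} {p u : Fin (n + 1) → R}
    (h : IsNormalFrame i j p u) (c : goodExponents d i j → R) (m : goodExponents d i j) :
    coeff m.1 (frameEquiv h (formOfCoeffs h c)) = c m := by
  classical
  simp [formOfCoeffs, coeff_sum, coeff_monomial]

lemma vanishesToOrder_formOfCoeffs {i j : Fin (n + 1)} {p u : Fin (n + 1) → k}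
    (h : IsNormalFrame i j p u) (c : goodExponents d i j → k) :
    VanishesToOrder d p u (formOfCoeffs h c) := by
  classical
  refine (vanishesToOrder_iff_coeff h (isHomogeneous_formOfCoeffs h c)).2 fun m hm => ?_
  simp only [formOfCoeffs, AlgEquiv.apply_symm_apply, coeff_sum, coeff_monomial]
  exact Finset.sum_eq_zero fun x _ => if_neg fun hx : x.1 = m => hm (hx ▸ x.2)

lemma eq_formOfCoeffs {i j : Fin (n + 1)} {p u : Fin (n + 1) → k}
    (h : IsNormalFrame i j p u) {f : MvPolynomial (Fin (n + 1)) k} (hf : f.IsHomogeneous d)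
    (hv : VanishesToOrder d p u f) :
    f = formOfCoeffs h (fun m : goodExponents d i j => coeff m.1 (frameEquiv h f)) := by
  classical
  rw [formOfCoeffs, AlgEquiv.eq_symm_apply]
  ext m
  simp only [coeff_sum, coeff_monomial]
  by_cases hm : m ∈ goodExponents d i j
  · rw [Finset.sum_eq_single (⟨m, hm⟩ : goodExponents d i j)]
    · simp
    · intro x _ hx
      exact if_neg fun h' => hx (Subtype.ext h')
    · simp
  · rw [(vanishesToOrder_iff_coeff h hf).1 hv m hm]
    exact (Finset.sum_eq_zero fun x _ => if_neg fun hx : x.1 = m => hm (hx ▸ x.2)).symm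

/-- Forms in a fiber are determined by their good coefficients. -/
def vanishingFormsEquiv {i j : Fin (n + 1)} {p u : Fin (n + 1) → k} (h : IsNormalFrame i j p u) :
    vanishingForms d p u ≃ₗ[k] (goodExponents d i j → k) where
  toFun f m := coeff m.1 (frameEquiv h f.1.1)
  map_add' f g := by ext; simp
  map_smul' c f := by ext; simp
  invFun c := ⟨⟨formOfCoeffs h c, isHomogeneous_formOfCoeffs h c⟩,
    vanishesToOrder_formOfCoeffs h c⟩
  left_inv f := by
    have := eq_formOfCoeffs h f.1.2 f.2
    ext1
    ext1
    exact this.symm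
  right_inv c := by
    ext m
    have := coeff_formOfCoeffs h c m
    exact this

lemma finrank_vanishingForms {i j : Fin (n + 1)} {p u : Fin (n + 1) → k}
    (h : IsNormalFrame i j p u) :
    Module.finrank k (vanishingForms d p u) = (n + d).choose d - d := by
  rw [(vanishingFormsEquiv h).finrank_eq, Module.finrank_fintype_fun_eq_card, Fintype.card_coe,
    card_goodExponents h.ne]

lemma exists_fiber {P : Projectivization k (Fin (n + 1) → k)}
    {L : Projectivization k (⋀[k]^2 (Fin (n + 1) → k))} (h : Incident k n P L) :
    ∃ W : Submodule k (homogeneousSubmodule (Fin (n + 1)) k d),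
      (∀ (f : homogeneousSubmodule (Fin (n + 1)) k d) (hf : f ≠ 0),
        ((P, L, Projectivization.mk k f hf) ∈ Tnd k n d ↔ f ∈ W)) ∧
      Module.finrank k W = (n + d).choose d - d := by
  obtain ⟨i, j, hi, hj⟩ := exists_rep_ne_zero h
  obtain ⟨p, u, hpu, rfl, rfl⟩ := exists_isNormalFrame h hi hj
  exact ⟨vanishingForms d p u, fun f hf => mk_wedge_mem_Tnd_iff hpu.wedge_ne_zero hf,
    finrank_vanishingForms hpu⟩

end Fibers

section Charts

variable {R S : Type} [CommRing R] [CommRing S] {i j : Fin (n + 1)}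

/-- The coordinates on the affine chart of the incidence variety where the `i`-th coordinate of
the point, the `(i, j)`-th Plücker coordinate of the line and the coefficient of the form at `m₀`
in adapted coordinates do not vanish. -/
abbrev ChartIndex (m₀ : goodExponents d i j) : Type :=
  {s : Fin (n + 1) // s ≠ i} ⊕ {s : Fin (n + 1) // s ≠ i ∧ s ≠ j} ⊕
    {m : goodExponents d i j // m ≠ m₀}

variable {m₀ : goodExponents d i j}

/-- The normalized point of a chart with given coordinates. -/
def chartPoint (x : ChartIndex m₀ → R) (s : Fin (n + 1)) : R :=
  if h : s = i then 1 else x (Sum.inl ⟨s, h⟩)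

/-- The normalized direction of a chart with given coordinates. -/
def chartDirection (x : ChartIndex m₀ → R) (s : Fin (n + 1)) : R :=
  if h : s = i then 0 else if h' : s = j then 1 else x (Sum.inr (Sum.inl ⟨s, h, h'⟩))

/-- The normalized coefficients of a chart with given coordinates. -/
def chartCoeffs (x : ChartIndex m₀ → R) (m : goodExponents d i j) : R :=
  if h : m = m₀ then 1 else x (Sum.inr (Sum.inr ⟨m, h⟩))

lemma isNormalFrame_chart (hij : i ≠ j) (x : ChartIndex m₀ → R) :
    IsNormalFrame i j (chartPoint x) (chartDirection x) :=
  ⟨hij, by simp [chartPoint], by simp [chartDirection], by simp [chartDirection, hij.symm]⟩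

lemma map_chartPoint (φ : R →+* S) (x : ChartIndex m₀ → R) (s : Fin (n + 1)) :
    φ (chartPoint x s) = chartPoint (fun t => φ (x t)) s := by
  simp only [chartPoint]
  split_ifs <;> simp

lemma map_chartDirection (φ : R →+* S) (x : ChartIndex m₀ → R) (s : Fin (n + 1)) :
    φ (chartDirection x s) = chartDirection (fun t => φ (x t)) s := by
  simp only [chartDirection]
  split_ifs <;> simp

lemma map_chartCoeffs (φ : R →+* S) (x : ChartIndex m₀ → R) (m : goodExponents d i j) :
    φ (chartCoeffs x m) = chartCoeffs (fun t => φ (x t)) m := by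
  simp only [chartCoeffs]
  split_ifs <;> simp

/-- The form of a chart with given coordinates. -/
def chartForm (hij : i ≠ j) (x : ChartIndex m₀ → R) : MvPolynomial (Fin (n + 1)) R :=
  formOfCoeffs (isNormalFrame_chart hij x) (chartCoeffs x)

lemma map_chartForm (hij : i ≠ j) (φ : R →+* S) (x : ChartIndex m₀ → R) :
    map φ (chartForm hij x) = chartForm hij fun t => φ (x t) := by
  rw [chartForm, chartForm, formOfCoeffs, formOfCoeffs, frameEquiv_symm_apply,
    frameEquiv_symm_apply]
  change map φ (bind₁ _ _) = bind₁ _ _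
  rw [map_bind₁]
  simp only [map_frameInv, map_sum, map_monomial, map_chartPoint, map_chartDirection,
    map_chartCoeffs]

lemma isHomogeneous_chartForm (hij : i ≠ j) (x : ChartIndex m₀ → R) :
    (chartForm hij x).IsHomogeneous d :=
  isHomogeneous_formOfCoeffs _ _

/-- The form of a chart, as an element of the space of forms. -/
def chartForm' (hij : i ≠ j) (x : ChartIndex m₀ → k) : homogeneousSubmodule (Fin (n + 1)) k d :=
  ⟨chartForm hij x, isHomogeneous_chartForm hij x⟩

lemma chartForm'_ne_zero (hij : i ≠ j) (x : ChartIndex m₀ → k) : chartForm' hij x ≠ 0 := by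
  intro h
  have h1 : coeff m₀.1 (frameEquiv (isNormalFrame_chart hij x) (chartForm hij x)) =
      chartCoeffs x m₀ := coeff_formOfCoeffs _ _ _
  rw [show chartForm hij x = 0 from congrArg Subtype.val h] at h1
  simp [chartCoeffs] at h1

lemma eval_chartPoint_X (x : ChartIndex m₀ → k) (s : Fin (n + 1)) :
    eval x (chartPoint (m₀ := m₀) X s) = chartPoint x s := by
  rw [map_chartPoint]
  simp

lemma eval_chartDirection_X (x : ChartIndex m₀ → k) (s : Fin (n + 1)) :
    eval x (chartDirection (m₀ := m₀) X s) = chartDirection x s := by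
  rw [map_chartDirection]
  simp

lemma eval_coeff_chartForm_X (hij : i ≠ j) (x : ChartIndex m₀ → k) (m : Fin (n + 1) →₀ ℕ) :
    eval x (coeff m (chartForm (m₀ := m₀) hij X)) = coeff m (chartForm hij x) := by
  rw [← coeff_map, map_chartForm]
  simp

lemma exists_eval_eq_chartPoint (l : (Fin (n + 1) → k) →ₗ[k] k) :
    ∃ g : MvPolynomial (ChartIndex m₀) k, ∀ x, l (chartPoint x) = eval x g := by
  refine ⟨∑ s, C (l (Pi.single s 1)) * chartPoint X s, fun x => ?_⟩
  rw [pi_eq_sum_univ' (chartPoint x)]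
  simp [eval_chartPoint_X, mul_comm]

lemma wedge_eq_sum (p u : Fin (n + 1) → k) : wedge k n p u =
    ∑ s, ∑ t, (p s * u t) • wedge k n (Pi.single s 1) (Pi.single t 1) := by
  ext
  conv_lhs => rw [pi_eq_sum_univ' p, pi_eq_sum_univ' u]
  simp only [wedge, map_sum, map_smul, Finset.sum_mul_sum, Submodule.coe_sum, Submodule.coe_smul]
  exact Finset.sum_congr rfl fun s _ => Finset.sum_congr rfl fun t _ =>
    smul_mul_smul_comm _ _ _ _

lemma exists_eval_eq_chartWedge (l : ⋀[k]^2 (Fin (n + 1) → k) →ₗ[k] k) :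
    ∃ g : MvPolynomial (ChartIndex m₀) k,
      ∀ x, l (wedge k n (chartPoint x) (chartDirection x)) = eval x g := by
  refine ⟨∑ s, ∑ t, C (l (wedge k n (Pi.single s 1) (Pi.single t 1))) *
    (chartPoint X s * chartDirection X t), fun x => ?_⟩
  rw [wedge_eq_sum]
  simp only [map_sum, map_smul, map_mul, eval_C, eval_chartPoint_X, eval_chartDirection_X,
    smul_eq_mul]
  exact Finset.sum_congr rfl fun s _ => Finset.sum_congr rfl fun t _ => mul_comm _ _

lemma form_eq_sum (f : homogeneousSubmodule (Fin (n + 1)) k d) :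
    f = ∑ m : Finset.finsuppAntidiag (Finset.univ : Finset (Fin (n + 1))) d,
      coeff m.1 (f : MvPolynomial (Fin (n + 1)) k) •
        (⟨monomial m.1 1, isHomogeneous_monomial _ (mem_finsuppAntidiag_univ.1 m.2)⟩ :
          homogeneousSubmodule (Fin (n + 1)) k d) := by
  ext1
  simp only [Submodule.coe_sum, Submodule.coe_smul, smul_monomial, smul_eq_mul, mul_one]
  rw [Finset.sum_coe_sort (Finset.finsuppAntidiag (Finset.univ : Finset (Fin (n + 1))) d)
    fun m => monomial m (coeff m (f : MvPolynomial (Fin (n + 1)) k))]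
  conv_lhs => rw [(f : MvPolynomial (Fin (n + 1)) k).as_sum]
  refine Finset.sum_subset ?_ ?_
  · intro x hx
    exact mem_finsuppAntidiag_univ.2 (degree_eq_of_mem_support f.2 hx)
  · intro x _ hx
    rw [notMem_support_iff.1 hx, monomial_zero]

lemma exists_eval_eq_chartForm (hij : i ≠ j)
    (l : homogeneousSubmodule (Fin (n + 1)) k d →ₗ[k] k) :
    ∃ g : MvPolynomial (ChartIndex m₀) k, ∀ x, l (chartForm' hij x) = eval x g := by
  refine ⟨∑ m : Finset.finsuppAntidiag (Finset.univ : Finset (Fin (n + 1))) d,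
    C (l ⟨monomial m.1 1, isHomogeneous_monomial _ (mem_finsuppAntidiag_univ.1 m.2)⟩) *
      coeff m.1 (chartForm hij X), fun x => ?_⟩
  rw [form_eq_sum (chartForm' hij x)]
  simp [eval_coeff_chartForm_X, mul_comm, chartForm']

/-- The coefficients of the form in adapted coordinates, as a trihomogeneous function. -/
def frameCoeff (i j : Fin (n + 1)) (m : Fin (n + 1) →₀ ℕ) (v : RepTriple k n d) : k :=
  coeff m (aeval (frameSubst i j (fun s => v.1 s * plucker i j v.2.1)
    (fun s => v.1 i * plucker i s v.2.1) (v.1 i * plucker i j v.2.1))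
      (v.2.2 : MvPolynomial (Fin (n + 1)) k))

lemma triForm.frameCoeff_mem (i j : Fin (n + 1)) (m : Fin (n + 1) →₀ ℕ) :
    frameCoeff i j m ∈ repForm k n d ((0, 0, 1) + d • (1, 1, 0)) := by
  have := triForm.coeff_aeval_mem (k := k) (n := n) (d := d) (M₁ := Fin (n + 1) → k)
    (M₂ := ⋀[k]^2 (Fin (n + 1) → k)) (τ := Fin (n + 1)) (e := (1, 1, 0))
    (frameSubst i j (fun s v => v.1 s * plucker i j v.2.1)
      (fun s v => v.1 i * plucker i s v.2.1) (fun v => v.1 i * plucker i j v.2.1)) (fun s => ?_) m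
  · simp only [map_frameSubst] at this
    exact this
  · refine Submodule.add_mem _ (Submodule.add_mem _ ?_ ?_) ?_
    · exact mul_X_mem_coeffsIn.2 (C_mem_coeffsIn.2 (triForm.coord_mul_plucker_mem _ _ _))
    · exact mul_X_mem_coeffsIn.2 (C_mem_coeffsIn.2 (triForm.coord_mul_plucker_mem _ _ _))
    · split_ifs
      · exact Submodule.zero_mem _
      · exact mul_X_mem_coeffsIn.2 (C_mem_coeffsIn.2 (triForm.coord_mul_plucker_mem _ _ _))

lemma frameCoeff_of_isNormalFrame {p u : Fin (n + 1) → k} (h : IsNormalFrame i j p u)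
    (m : Fin (n + 1) →₀ ℕ) (f : homogeneousSubmodule (Fin (n + 1)) k d) :
    frameCoeff i j m (p, wedge k n p u, f) = coeff m (frameEquiv h f.1) := by
  simp [frameCoeff, frameEquiv_apply, h.fst_left, h.snd_left, h.snd_right]

attribute [local instance] affineZariskiTopology

/-- The chart, as a map to the ambient space. -/
def chartMap (hij : i ≠ j) (x : ChartIndex m₀ → k) : AmbientSpace k n d :=
  (Projectivization.mk k (chartPoint x) (isNormalFrame_chart hij x).fst_ne_zero,
    Projectivization.mk k (wedge k n (chartPoint x) (chartDirection x))
      (isNormalFrame_chart hij x).wedge_ne_zero,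
    Projectivization.mk k (chartForm' hij x) (chartForm'_ne_zero hij x))

lemma chartMap_mem_Tnd (hij : i ≠ j) (x : ChartIndex m₀ → k) : chartMap hij x ∈ Tnd k n d :=
  (mk_wedge_mem_Tnd_iff _ _).2 (vanishesToOrder_formOfCoeffs _ _)

lemma isInducing_chartMap (hij : i ≠ j) :
    Topology.IsInducing (chartMap (k := k) (m₀ := m₀) hij) := by
  have hf := fun x : ChartIndex m₀ → k => isNormalFrame_chart hij x
  have hc : ∀ (x : ChartIndex m₀ → k) (m : goodExponents d i j),
      coeff m.1 (frameEquiv (hf x) (chartForm' hij x).1) = chartCoeffs x m :=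
    fun x m => coeff_formOfCoeffs _ _ _
  refine isInducing_mk_of_polynomial _ _ _ exists_eval_eq_chartPoint exists_eval_eq_chartWedge
    (exists_eval_eq_chartForm hij)
    (Sum.elim (fun _ => (1, 0, 0)) (Sum.elim (fun _ => (0, 1, 0))
      fun _ => (0, 0, 1) + d • (1, 1, 0)))
    (Sum.elim (fun s v => v.1 s.1) (Sum.elim (fun s v => plucker i s.1 v.2.1)
      fun m => frameCoeff i j m.1.1))
    (Sum.elim (fun _ v => v.1 i) (Sum.elim (fun _ v => plucker i j v.2.1)
      fun _ => frameCoeff i j m₀.1)) ?_ ?_ ?_ ?_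
  · rintro (s | s | m)
    · exact triForm.coord_mem s.1
    · exact triForm.plucker_mem i s.1
    · exact triForm.frameCoeff_mem i j m.1.1
  · rintro (s | s | m)
    · exact triForm.coord_mem i
    · exact triForm.plucker_mem i j
    · exact triForm.frameCoeff_mem i j m₀.1
  · rintro (s | s | m) x
    · simp [chartPoint, s.2]
    · simp [(hf x).fst_left, (hf x).snd_left]
      simp [chartDirection, s.2.1, s.2.2]
    · simp [frameCoeff_of_isNormalFrame (hf x), hc, chartCoeffs, m.2]
  · rintro (s | s | m) x
    · simp [chartPoint]
    · simp [(hf x).fst_left, (hf x).snd_left, (hf x).snd_right]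
    · simp [frameCoeff_of_isNormalFrame (hf x), hc, chartCoeffs]

end Charts

section ChartCover

variable {i j : Fin (n + 1)} {m₀ : goodExponents d i j}

/-- The form whose non-vanishing locus in the incidence variety is the chart `(i, j, m)`. -/
def chartDenominator (i j : Fin (n + 1)) (m : Fin (n + 1) →₀ ℕ) (v : RepTriple k n d) : k :=
  v.1 i * plucker i j v.2.1 * frameCoeff i j m v

lemma triForm.chartDenominator_mem (i j : Fin (n + 1)) (m : Fin (n + 1) →₀ ℕ) :
    chartDenominator i j m ∈ repForm k n d ((1, 1, 0) + ((0, 0, 1) + d • (1, 1, 0))) :=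
  SetLike.mul_mem_graded (triForm.coord_mul_plucker_mem i i j) (triForm.frameCoeff_mem i j m)

/-- The domain of a chart, in the ambient space. -/
def chartDomain (i j : Fin (n + 1)) (m : Fin (n + 1) →₀ ℕ) : Set (AmbientSpace k n d) :=
  triNonvanishing (chartDenominator i j m)

lemma mk_mem_chartDomain_iff {p u : Fin (n + 1) → k} (h : IsNormalFrame i j p u)
    (m : Fin (n + 1) →₀ ℕ) {f : homogeneousSubmodule (Fin (n + 1)) k d} (hf : f ≠ 0) :
    (Projectivization.mk k p h.fst_ne_zero, Projectivization.mk k (wedge k n p u) h.wedge_ne_zero,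
      Projectivization.mk k f hf) ∈ chartDomain i j m ↔ coeff m (frameEquiv h f.1) ≠ 0 := by
  rw [chartDomain, mk_mem_triNonvanishing (triForm.chartDenominator_mem i j m), chartDenominator,
    frameCoeff_of_isNormalFrame h]
  simp [h.fst_left, h.snd_left, h.snd_right]

lemma chartMap_mem_chartDomain (hij : i ≠ j) (x : ChartIndex m₀ → k) :
    chartMap hij x ∈ chartDomain i j m₀.1 := by
  refine (mk_mem_chartDomain_iff (isNormalFrame_chart hij x) _ _).2 ?_
  have : coeff m₀.1 (frameEquiv (isNormalFrame_chart hij x) (chartForm' hij x).1) =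
      chartCoeffs x m₀ := coeff_formOfCoeffs _ _ _
  simp [this, chartCoeffs]

lemma exists_chartMap_eq {p u : Fin (n + 1) → k} (h : IsNormalFrame i j p u)
    {f : homogeneousSubmodule (Fin (n + 1)) k d} (hf : f ≠ 0) (hv : VanishesToOrder d p u f.1)
    (hm : coeff m₀.1 (frameEquiv h f.1) ≠ 0) :
    ∃ x : ChartIndex m₀ → k, chartMap h.ne x = (Projectivization.mk k p h.fst_ne_zero,
      Projectivization.mk k (wedge k n p u) h.wedge_ne_zero, Projectivization.mk k f hf) := by
  set c := coeff m₀.1 (frameEquiv h f.1) with hc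
  refine ⟨Sum.elim (fun s => p s.1) (Sum.elim (fun s => u s.1)
    fun m => c⁻¹ * coeff m.1.1 (frameEquiv h f.1)), ?_⟩
  set x : ChartIndex m₀ → k := Sum.elim (fun s => p s.1) (Sum.elim (fun s => u s.1)
    fun m => c⁻¹ * coeff m.1.1 (frameEquiv h f.1)) with hx
  have hp : chartPoint x = p := by
    ext s
    by_cases hs : s = i
    · simp [chartPoint, hs, h.fst_left]
    · simp [chartPoint, hs, hx]
  have hu : chartDirection x = u := by
    ext s
    by_cases hs : s = i
    · simp [chartDirection, hs, h.snd_left]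
    · by_cases hs' : s = j
      · simp [chartDirection, hs', h.ne.symm, h.snd_right]
      · simp [chartDirection, hs, hs', hx]
  have hcf : chartCoeffs x = fun m => coeff m.1 (frameEquiv h (c⁻¹ • f).1) := by
    ext m
    by_cases hs : m = m₀
    · simp [chartCoeffs, hs, ← hc, hm]
    · simp [chartCoeffs, hs, hx]
  have hfm : chartForm' h.ne x = c⁻¹ • f := by
    refine Subtype.ext ?_
    rw [eq_formOfCoeffs h (c⁻¹ • f).2 ((vanishingForms d p u).smul_mem c⁻¹ hv), ← hcf]
    simp only [chartForm', chartForm, formOfCoeffs, frameEquiv_symm_apply, hp, hu]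
  refine Prod.ext ?_ (Prod.ext ?_ ?_)
  · simp only [chartMap, hp]
  · simp only [chartMap, hp, hu]
  · simp only [chartMap, Projectivization.mk_eq_mk_iff']
    exact ⟨c⁻¹, hfm.symm⟩

lemma exists_mk_eq_of_mem_Tnd {z : AmbientSpace k n d} (hz : z ∈ Tnd k n d)
    (hi : z.1.rep i ≠ 0) (hj : plucker i j z.2.1.rep ≠ 0) :
    ∃ (p u : Fin (n + 1) → k) (h : IsNormalFrame i j p u)
      (f : homogeneousSubmodule (Fin (n + 1)) k d) (hf : f ≠ 0), VanishesToOrder d p u f.1 ∧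
      z = (Projectivization.mk k p h.fst_ne_zero,
        Projectivization.mk k (wedge k n p u) h.wedge_ne_zero, Projectivization.mk k f hf) := by
  obtain ⟨P, L, F⟩ := z
  obtain ⟨p, u, h, rfl, rfl⟩ := exists_isNormalFrame hz.2.1 hi hj
  refine ⟨p, u, h, F.rep, F.rep_nonzero, ?_, by rw [F.mk_rep]⟩
  rw [← F.mk_rep] at hz
  exact (mk_wedge_mem_Tnd_iff h.wedge_ne_zero F.rep_nonzero).1 hz

lemma range_chartMap (hij : i ≠ j) :
    Set.range (chartMap (k := k) (m₀ := m₀) hij) = Tnd k n d ∩ chartDomain i j m₀.1 := by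
  refine subset_antisymm ?_ ?_
  · rintro _ ⟨x, rfl⟩
    exact ⟨chartMap_mem_Tnd hij x, chartMap_mem_chartDomain hij x⟩
  · rintro z ⟨hz, hz'⟩
    have hne : chartDenominator i j m₀.1 (z.1.rep, z.2.1.rep, z.2.2.rep) ≠ 0 := hz'
    have hne' := left_ne_zero_of_mul hne
    obtain ⟨p, u, h, f, hf, hv, rfl⟩ :=
      exists_mk_eq_of_mem_Tnd hz (left_ne_zero_of_mul hne') (right_ne_zero_of_mul hne')
    exact exists_chartMap_eq h hf hv ((mk_mem_chartDomain_iff h _ hf).1 hz')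

lemma exists_mem_chartDomain {z : AmbientSpace k n d} (hz : z ∈ Tnd k n d) :
    ∃ (i j : Fin (n + 1)) (_ : i ≠ j) (m : goodExponents d i j), z ∈ chartDomain i j m.1 := by
  obtain ⟨i, j, hi, hj⟩ := exists_rep_ne_zero hz.2.1
  obtain ⟨p, u, h, f, hf, hv, rfl⟩ := exists_mk_eq_of_mem_Tnd hz hi hj
  have : frameEquiv h f.1 ≠ 0 := by simpa using hf
  obtain ⟨m, hm⟩ := exists_coeff_ne_zero this
  have hgood : m ∈ goodExponents d i j := by
    by_contra hgood
    exact hm ((vanishesToOrder_iff_coeff h f.2).1 hv m hgood)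
  exact ⟨i, j, h.ne, ⟨m, hgood⟩, (mk_mem_chartDomain_iff h m hf).2 hm⟩

lemma card_chartIndex (hn : 1 ≤ n) (hij : i ≠ j) :
    Nat.card (ChartIndex m₀) = 2 * n + (n + d).choose d - 2 - d := by
  classical
  have h1 : Fintype.card {s : Fin (n + 1) // s ≠ i} = n := by
    simp [Fintype.card_subtype_compl]
  have h2 : Fintype.card {s : Fin (n + 1) // s ≠ i ∧ s ≠ j} = n - 1 := by
    rw [Fintype.card_subtype]
    have : (Finset.univ.filter fun s : Fin (n + 1) => s ≠ i ∧ s ≠ j) =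
        (Finset.univ.erase i).erase j := by
      ext s
      simp [and_comm]
    rw [this, Finset.card_erase_of_mem (by simp [hij.symm]), Finset.card_erase_of_mem (by simp)]
    simp
  have h3 : Fintype.card {m : goodExponents d i j // m ≠ m₀} = (n + d).choose d - d - 1 := by
    simp [Fintype.card_subtype_compl, card_goodExponents hij]
  have h4 : 0 < (n + d).choose d - d := by
    rw [← card_goodExponents hij]
    exact Finset.card_pos.2 ⟨_, m₀.2⟩
  rw [Nat.card_eq_fintype_card, Fintype.card_sum, Fintype.card_sum, h1, h2, h3]
  omega

/-- A coefficient of forms in adapted coordinates, as a linear functional. -/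
def frameFunctional {p u : Fin (n + 1) → k} (h : IsNormalFrame i j p u) (m : Fin (n + 1) →₀ ℕ) :
    Module.Dual k (homogeneousSubmodule (Fin (n + 1)) k d) :=
  lcoeff k m ∘ₗ (frameEquiv h).toLinearMap ∘ₗ Submodule.subtype _

lemma frameFunctional_apply {p u : Fin (n + 1) → k} (h : IsNormalFrame i j p u)
    (m : Fin (n + 1) →₀ ℕ) (f : homogeneousSubmodule (Fin (n + 1)) k d) :
    frameFunctional h m f = coeff m (frameEquiv h f.1) := rfl

lemma mk_mem_chartDomain_iff_of_smul_add {p u : Fin (n + 1) → k} {a b : k}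
    (h : IsNormalFrame i j p (a • u + b • p)) (hw : wedge k n p u ≠ 0)
    (m : Fin (n + 1) →₀ ℕ) {f : homogeneousSubmodule (Fin (n + 1)) k d} (hf : f ≠ 0) :
    (Projectivization.mk k p h.fst_ne_zero, Projectivization.mk k (wedge k n p u) hw,
      Projectivization.mk k f hf) ∈ chartDomain i j m ↔ frameFunctional h m f ≠ 0 := by
  rw [frameFunctional_apply, ← mk_mem_chartDomain_iff h m hf]
  suffices Projectivization.mk k (wedge k n p u) hw =
      Projectivization.mk k (wedge k n p (a • u + b • p)) h.wedge_ne_zero by rw [this]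
  symm
  rw [Projectivization.mk_eq_mk_iff']
  refine ⟨a, ?_⟩
  simpa using (wedge_smul_add p u 1 a b).symm

lemma exists_frameFunctional_ne_zero {p u : Fin (n + 1) → k} {a b : k} (ha : a ≠ 0)
    (h : IsNormalFrame i j p (a • u + b • p)) (m₀ : goodExponents d i j) :
    ∃ f ∈ vanishingForms d p u, frameFunctional h m₀.1 f ≠ 0 := by
  refine ⟨⟨_, isHomogeneous_formOfCoeffs h fun _ => 1⟩, ?_, ?_⟩
  · have := (vanishesToOrder_formOfCoeffs h fun _ => 1).smul_add
      (isHomogeneous_formOfCoeffs (d := d) h fun _ => 1) 1 a⁻¹ (-(a⁻¹ * b))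
    rw [one_smul, smul_add, smul_smul, smul_smul, inv_mul_cancel₀ ha, one_smul, add_assoc,
      neg_smul, add_neg_cancel, add_zero] at this
    exact this
  · rw [frameFunctional_apply]
    simp [coeff_formOfCoeffs]

/-- Any two charts intersect. -/
lemma nonempty_inter_chartDomain [Infinite k] {i' j' : Fin (n + 1)} (hij : i ≠ j)
    (hij' : i' ≠ j') (m : goodExponents d i j) (m' : goodExponents d i' j') :
    (Tnd k n d ∩ chartDomain i j m.1 ∩ chartDomain i' j' m'.1).Nonempty := by
  obtain ⟨w⟩ : Nonempty (Fin (n + 1) ↪ k) :=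
    ⟨Fin.valEmbedding.trans (Infinite.natEmbedding k)⟩
  have hframe : ∀ {s t : Fin (n + 1)}, s ≠ t →
      IsNormalFrame s t (1 : Fin (n + 1) → k)
        ((w t - w s)⁻¹ • ⇑w + (-((w t - w s)⁻¹ * w s)) • (1 : Fin (n + 1) → k)) := by
    intro s t hst
    have h0 : w t - w s ≠ 0 := sub_ne_zero.2 fun h => hst (w.injective h).symm
    refine ⟨hst, by simp, by simp, ?_⟩
    simp only [Pi.add_apply, Pi.smul_apply, Pi.one_apply, smul_eq_mul, mul_one]
    field_simp
    ring
  have hne : ∀ {s t : Fin (n + 1)}, s ≠ t → (w t - w s)⁻¹ ≠ 0 := fun hst =>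
    inv_ne_zero (sub_ne_zero.2 fun h => hst (w.injective h).symm)
  have hw : wedge k n 1 w ≠ 0 := by
    intro h
    have := congrArg (plucker i j) h
    simp [sub_eq_zero, hij.symm] at this
  obtain ⟨f, hf, hfm⟩ := Module.Dual.exists_forall_mem_ne_zero_of_forall_exists
    (vanishingForms d 1 w) (Bool.rec (frameFunctional (hframe hij) m.1)
      (frameFunctional (hframe hij') m'.1)) (by
        rintro (_ | _)
        · exact exists_frameFunctional_ne_zero (hne hij) (hframe hij) m
        · exact exists_frameFunctional_ne_zero (hne hij') (hframe hij') m')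
  have hf0 : f ≠ 0 := by
    rintro rfl
    exact hfm false (map_zero _)
  exact ⟨_, ⟨(mk_wedge_mem_Tnd_iff hw hf0).2 hf,
    (mk_mem_chartDomain_iff_of_smul_add (hframe hij) hw m.1 hf0).2 (hfm false)⟩,
    (mk_mem_chartDomain_iff_of_smul_add (hframe hij') hw m'.1 hf0).2 (hfm true)⟩

attribute [local instance] affineZariskiTopology

lemma isOpen_chartDomain (i j : Fin (n + 1)) (m : Fin (n + 1) →₀ ℕ) :
    IsOpen (chartDomain (k := k) (n := n) (d := d) i j m) :=
  isOpen_triNonvanishing (triForm.chartDenominator_mem i j m)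

lemma injective_chartMap (hij : i ≠ j) :
    Function.Injective (chartMap (k := k) (m₀ := m₀) hij) := by
  have : T0Space (ChartIndex m₀ → k) := AffineZariski.t0Space
  exact (isInducing_chartMap hij).injective

/-- The chart, as a map to the incidence variety. -/
def chartToTnd (hij : i ≠ j) (x : ChartIndex m₀ → k) : Tnd k n d :=
  ⟨chartMap hij x, chartMap_mem_Tnd hij x⟩

lemma range_chartToTnd (hij : i ≠ j) :
    Set.range (chartToTnd (k := k) (m₀ := m₀) hij) = Subtype.val ⁻¹' chartDomain i j m₀.1 := by
  ext ⟨z, hz⟩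
  have := Set.ext_iff.1 (range_chartMap (k := k) (m₀ := m₀) hij) z
  simpa [chartToTnd, hz] using this

lemma isOpenEmbedding_chartToTnd (hij : i ≠ j) :
    Topology.IsOpenEmbedding (chartToTnd (k := k) (m₀ := m₀) hij) where
  toIsInducing := (isInducing_chartMap hij).codRestrict _
  injective := Function.Injective.codRestrict _ (injective_chartMap hij)
  isOpen_range := by
    rw [range_chartToTnd]
    exact (isOpen_chartDomain i j m₀.1).preimage continuous_subtype_val

lemma topologicalKrullDim_Tnd [Infinite k] (hn : 1 ≤ n) :
    topologicalKrullDim (Tnd k n d) =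
      ((2 * n + (n + d).choose d - 2 - d : ℕ) : WithBot ℕ∞) := by
  refine le_antisymm ?_ ?_
  · refine topologicalKrullDim_le_of_forall_isOpenEmbedding _ fun z => ?_
    obtain ⟨i, j, hij, m, hz⟩ := exists_mem_chartDomain z.2
    refine ⟨_, _, _, isOpenEmbedding_chartToTnd (m₀ := m) hij, ?_, ?_⟩
    · rw [range_chartToTnd]
      exact hz
    · rw [AffineZariski.topologicalKrullDim_eq, card_chartIndex hn hij]
  · have : NeZero n := ⟨Nat.one_le_iff_ne_zero.1 hn⟩
    have h01 : (0 : Fin (n + 1)) ≠ Fin.last n := (Fin.last_pos' (n := n)).ne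
    rw [← card_chartIndex (m₀ := ⟨_, single_mem_goodExponents h01⟩) hn h01,
      ← AffineZariski.topologicalKrullDim_eq (k := k)]
    exact (isOpenEmbedding_chartToTnd h01).isInducing.topologicalKrullDim_le

lemma isIrreducible_Tnd [Infinite k] (hn : 1 ≤ n) : IsIrreducible (Tnd k n d) := by
  have hirr : ∀ {i j : Fin (n + 1)} (_ : i ≠ j) (m : goodExponents d i j),
      IsPreirreducible (Tnd k n d ∩ chartDomain i j m.1) := by
    intro i j hij m
    have := AffineZariski.irreducibleSpace (k := k) (σ := ChartIndex m)
    rw [← range_chartMap hij, ← Set.image_univ]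
    exact (PreirreducibleSpace.isPreirreducible_univ).image _
      (isInducing_chartMap hij).continuous.continuousOn
  refine ⟨?_, ?_⟩
  · have : NeZero n := ⟨Nat.one_le_iff_ne_zero.1 hn⟩
    have h01 : (0 : Fin (n + 1)) ≠ Fin.last n := (Fin.last_pos' (n := n)).ne
    exact ⟨_, chartMap_mem_Tnd (m₀ := ⟨_, single_mem_goodExponents h01⟩) h01 0⟩
  · rintro U V hU hV ⟨x, hxT, hxU⟩ ⟨y, hyT, hyV⟩
    obtain ⟨i, j, hij, m, hx⟩ := exists_mem_chartDomain hxT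
    obtain ⟨i', j', hij', m', hy⟩ := exists_mem_chartDomain hyT
    obtain ⟨z, ⟨hzT, -⟩, hzU, hz⟩ := hirr hij m U _ hU (isOpen_chartDomain i' j' m'.1)
      ⟨x, ⟨hxT, hx⟩, hxU⟩ (nonempty_inter_chartDomain hij hij' m m')
    exact (hirr hij' m' U V hU hV ⟨z, ⟨hzT, hz⟩, hzU⟩ ⟨y, ⟨hyT, hy⟩, hyV⟩).mono
      (Set.inter_subset_inter_left _ Set.inter_subset_left)

end ChartCover

end Auxiliary

theorem Tnd_closed_irreducible_dim [IsAlgClosed k] (hn : 1 ≤ n) (hd : 1 ≤ d) :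
    IsClosed (Tnd k n d) ∧
    IsIrreducible (Tnd k n d) ∧
    topologicalKrullDim (Tnd k n d)
      = ((2*n + Nat.choose (n+d) d - 2 - d : ℕ) : WithBot ℕ∞) ∧
    -- every fiber of the projection `T_{n,d} → W_n` is a projective linear subspace of
    -- `L_{n,d}` of dimension `dim L_{n,d} − d`:
    (∀ (P : Projectivization k (Fin (n+1) → k))
        (L : Projectivization k (⋀[k]^2 (Fin (n+1) → k))),
      IsLine k n L → Incident k n P L →
      ∃ W : Submodule k (homogeneousSubmodule (Fin (n+1)) k d),
        (∀ (f : homogeneousSubmodule (Fin (n+1)) k d) (hf : f ≠ 0),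
          ((P, L, Projectivization.mk k f hf) ∈ Tnd k n d ↔ f ∈ W)) ∧
        Module.finrank k W = Nat.choose (n+d) d - d) := by
  exact ⟨isClosed_Tnd, isIrreducible_Tnd hn, topologicalKrullDim_Tnd hn,
    fun _ _ _ h => exists_fiber h⟩

end
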